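/- arXiv:1301.6540 — 3 statements merged into one kernel-verified Lean document; each statement's English description precedes it below -/
import Mathlib

section
/- Let M^c_n denote the maximum of cr^c(π) over all set partitions π of [n]. Then for every integer n ≥ 5: if n ≡ 0 (mod 3), then M^c_n = ⌊(2/3)·C(n−1,2)⌋; if n ≡ 1 or 2 (mod 3), then M^c_n = ⌊(2/3)·C(n−2,2)⌋. -/
open Finset

/-- Two elements lie in the same block of the set partition `π` of `[n]`. -/
def sameBlock {n : ℕ} (π : Finpartition (univ : Finset (Fin n))) (a b : Fin n) : Prop :=
  ∃ B ∈ π.parts, a ∈ B ∧ b ∈ B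

/-- `(a, b)` is an arc of `π`: `a < b`, they lie in a common block, and no element of that
block lies strictly between them. -/
def IsArc {n : ℕ} (π : Finpartition (univ : Finset (Fin n))) (a b : Fin n) : Prop :=
  a < b ∧ sameBlock π a b ∧ ∀ c : Fin n, a < c → c < b → ¬ sameBlock π a c

/-- The linear crossing number `cr^ℓ(π)`: the number of pairs of arcs
`((a,b),(c,d))` with `a < c < b < d`. -/
noncomputable def crl {n : ℕ} (π : Finpartition (univ : Finset (Fin n))) : ℕ :=
  Set.ncard {q : (Fin n × Fin n) × (Fin n × Fin n) |
    IsArc π q.1.1 q.1.2 ∧ IsArc π q.2.1 q.2.2 ∧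
    q.1.1 < q.2.1 ∧ q.2.1 < q.1.2 ∧ q.1.2 < q.2.2}

/-- `(a, b)` is a chord of `π`: `a < b` lie in a common block `B`, and either they are
consecutive elements of `B`, or `B` has at least 3 elements and `a = min B`, `b = max B`. -/
def IsChord {n : ℕ} (π : Finpartition (univ : Finset (Fin n))) (a b : Fin n) : Prop :=
  a < b ∧ ∃ B ∈ π.parts, a ∈ B ∧ b ∈ B ∧
    ((∀ c ∈ B, ¬(a < c ∧ c < b)) ∨ (3 ≤ B.card ∧ ∀ c ∈ B, a ≤ c ∧ c ≤ b))

/-- The circular crossing number `cr^c(π)`: the number of unordered pairs of crossing chords,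
counted as ordered pairs `((a,b),(c,d))` of chords with `a < c < b < d`. -/
noncomputable def crc {n : ℕ} (π : Finpartition (univ : Finset (Fin n))) : ℕ :=
  Set.ncard {q : (Fin n × Fin n) × (Fin n × Fin n) |
    IsChord π q.1.1 q.1.2 ∧ IsChord π q.2.1 q.2.2 ∧
    q.1.1 < q.2.1 ∧ q.2.1 < q.1.2 ∧ q.1.2 < q.2.2}

/-- The Stirling number of the second kind `S(n,k)`: the number of set partitions of `[n]`
into exactly `k` blocks. -/
noncomputable def stirling (n k : ℕ) : ℕ :=
  Nat.card {π : Finpartition (univ : Finset (Fin n)) // π.parts.card = k}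

/-- Stirling numbers with integer arguments: `S(m,j) = 0` unless `0 ≤ j ≤ m`. -/
noncomputable def stirlingZ (m j : ℤ) : ℕ :=
  if 0 ≤ m ∧ 0 ≤ j then stirling m.toNat j.toNat else 0

/-- The Bell number `B_n`: the number of set partitions of `[n]`. -/
noncomputable def bell (n : ℕ) : ℕ :=
  Nat.card (Finpartition (univ : Finset (Fin n)))

/-- The set partitions of `[n]` with exactly `k` blocks, as a `Finset`. -/
def Pik (n k : ℕ) : Finset (Finpartition (univ : Finset (Fin n))) :=
  Finset.univ.filter fun π => π.parts.card = k

/-- The mean of the linear crossing number over `Π_n^k`. -/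
noncomputable def EX (n k : ℕ) : ℝ :=
  (∑ π ∈ Pik n k, (crl π : ℝ)) / stirling n k

/-- The variance of the linear crossing number over `Π_n^k`. -/
noncomputable def VarX (n k : ℕ) : ℝ :=
  (∑ π ∈ Pik n k, (crl π : ℝ) ^ 2) / stirling n k - EX n k ^ 2

/-- The mean of the circular crossing number over `Π_n^k`. -/
noncomputable def EY (n k : ℕ) : ℝ :=
  (∑ π ∈ Pik n k, (crc π : ℝ)) / stirling n k

/-- The variance of the circular crossing number over `Π_n^k`. -/
noncomputable def VarY (n k : ℕ) : ℝ :=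
  (∑ π ∈ Pik n k, (crc π : ℝ) ^ 2) / stirling n k - EY n k ^ 2

/-- The mean of the linear crossing number over all of `Π_n`. -/
noncomputable def EXall (n : ℕ) : ℝ :=
  (∑ π : Finpartition (univ : Finset (Fin n)), (crl π : ℝ)) / bell n

/-- The variance of the linear crossing number over all of `Π_n`. -/
noncomputable def VarXall (n : ℕ) : ℝ :=
  (∑ π : Finpartition (univ : Finset (Fin n)), (crl π : ℝ) ^ 2) / bell n - EXall n ^ 2

/-- The mean of the circular crossing number over all of `Π_n`. -/
noncomputable def EYall (n : ℕ) : ℝ :=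
  (∑ π : Finpartition (univ : Finset (Fin n)), (crc π : ℝ)) / bell n

/-- The variance of the circular crossing number over all of `Π_n`. -/
noncomputable def VarYall (n : ℕ) : ℝ :=
  (∑ π : Finpartition (univ : Finset (Fin n)), (crc π : ℝ) ^ 2) / bell n - EYall n ^ 2

/-- The standard normal distribution function `Φ`. -/
noncomputable def stdNormalCDF (x : ℝ) : ℝ :=
  (Real.sqrt (2 * Real.pi))⁻¹ * ∫ t in Set.Iic x, Real.exp (-t ^ 2 / 2)

section Chords

variable {α : Type*} [LinearOrder α]

/-- `e` is a side of the polygon with vertex set `B`. -/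
def IsSide (B : Finset α) (e : α × α) : Prop :=
  e.1 < e.2 ∧ e.1 ∈ B ∧ e.2 ∈ B ∧
    ((∀ c ∈ B, ¬(e.1 < c ∧ c < e.2)) ∨ (3 ≤ B.card ∧ ∀ c ∈ B, e.1 ≤ c ∧ c ≤ e.2))

open Classical in
/-- The sides of the polygon with vertex set `B`. -/
noncomputable def sides (B : Finset α) : Finset (α × α) :=
  (B ×ˢ B).filter (IsSide B)

/-- The chords `e` and `f` cross. -/
def Crosses (e f : α × α) : Prop :=
  (e.1 < f.1 ∧ f.1 < e.2 ∧ e.2 < f.2) ∨ (f.1 < e.1 ∧ e.1 < f.2 ∧ f.2 < e.2)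

lemma mem_sides {B : Finset α} {e : α × α} : e ∈ sides B ↔ IsSide B e := by
  simp only [sides, mem_filter, mem_product, and_iff_right_iff_imp]
  exact fun h => ⟨h.2.1, h.2.2.1⟩

lemma not_crosses_of_isSide {B : Finset α} {e f : α × α} (he : IsSide B e) (hf : IsSide B f) :
    ¬ Crosses e f := by
  obtain ⟨_, he1, he2, he⟩ := he
  obtain ⟨_, hf1, hf2, hf⟩ := hf
  rintro (⟨h1, h2, h3⟩ | ⟨h1, h2, h3⟩)
  · rcases he with he | ⟨_, he⟩
    · exact he _ hf1 ⟨h1, h2⟩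
    · exact absurd h3 (not_lt.2 (he _ hf2).2)
  · rcases hf with hf | ⟨_, hf⟩
    · exact hf _ he1 ⟨h1, h2⟩
    · exact absurd h3 (not_lt.2 (hf _ he2).2)

/-- Two gaps of `B` sharing an interior point are equal. -/
lemma eq_of_gaps_meet {B : Finset α} {e f : α × α} {x : α}
    (he1 : e.1 ∈ B) (he2 : e.2 ∈ B) (he : ∀ c ∈ B, ¬(e.1 < c ∧ c < e.2))
    (hf1 : f.1 ∈ B) (hf2 : f.2 ∈ B) (hf : ∀ c ∈ B, ¬(f.1 < c ∧ c < f.2))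
    (hex1 : e.1 ≤ x) (hex2 : x < e.2) (hfx1 : f.1 ≤ x) (hfx2 : x < f.2) : e = f := by
  apply Prod.ext
  · apply le_antisymm
    · exact not_lt.1 fun h => hf _ he1 ⟨h, hex1.trans_lt hfx2⟩
    · exact not_lt.1 fun h => he _ hf1 ⟨h, hfx1.trans_lt hex2⟩
  · apply le_antisymm
    · exact not_lt.1 fun h => he _ hf2 ⟨hex1.trans_lt hfx2, h⟩
    · exact not_lt.1 fun h => hf _ he2 ⟨hfx1.trans_lt hex2, h⟩

lemma card_sides_le (B : Finset α) : (sides B).card ≤ B.card := by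
  classical
  refine Finset.card_le_card_of_injOn
    (fun e => if ∀ c ∈ B, ¬(e.1 < c ∧ c < e.2) then e.1 else e.2) ?_ ?_
  · intro e he
    have he := mem_sides.1 (mem_coe.1 he)
    dsimp only
    split_ifs
    · exact he.2.1
    · exact he.2.2.1
  · intro e he f hf hef
    obtain ⟨he0, he1, he2, he⟩ := mem_sides.1 (mem_coe.1 he)
    obtain ⟨hf0, hf1, hf2, hf⟩ := mem_sides.1 (mem_coe.1 hf)
    dsimp only at hef
    split_ifs at hef with h1 h2 h2
    · exact eq_of_gaps_meet he1 he2 h1 hf1 hf2 h2 le_rfl he0 hef.ge (hef.trans_lt hf0)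
    · have := (hf.resolve_left h2).2 _ he2
      exact absurd he0 (not_lt.2 (hef ▸ this.2))
    · have := (he.resolve_left h1).2 _ hf2
      exact absurd hf0 (not_lt.2 (hef ▸ this.2))
    · have h3 := (he.resolve_left h1).2 _ hf1
      have h4 := (hf.resolve_left h2).2 _ he1
      exact Prod.ext (le_antisymm h3.1 h4.1) hef

lemma card_sides_le_pred {B : Finset α} (hB : B.card < 3) : (sides B).card ≤ B.card - 1 := by
  classical
  rcases B.eq_empty_or_nonempty with rfl | hne
  · simp [sides]
  rw [← card_erase_of_mem (B.max'_mem hne)]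
  refine Finset.card_le_card_of_injOn Prod.fst ?_ ?_
  · intro e he
    have he := mem_sides.1 (mem_coe.1 he)
    exact mem_coe.2 (mem_erase.2 ⟨(he.1.trans_le (B.le_max' _ he.2.2.1)).ne, he.2.1⟩)
  · intro e he f hf hef
    obtain ⟨he0, he1, he2, he⟩ := mem_sides.1 (mem_coe.1 he)
    obtain ⟨hf0, hf1, hf2, hf⟩ := mem_sides.1 (mem_coe.1 hf)
    exact eq_of_gaps_meet he1 he2 (he.resolve_right fun h => by omega) hf1 hf2
      (hf.resolve_right fun h => by omega) le_rfl he0 hef.ge (hef.trans_lt hf0)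

open Classical in
/-- A line crosses at most two sides of a convex polygon. -/
lemma card_sides_crosses_le_two (B : Finset α) (e : α × α) :
    ((sides B).filter (Crosses e)).card ≤ 2 := by
  rw [← Fintype.card_bool, ← card_univ]
  refine Finset.card_le_card_of_injOn
    (fun f => if ∀ c ∈ B, ¬(f.1 < c ∧ c < f.2) then decide (f.1 < e.1 ∧ e.1 < f.2)
      else decide (f.1 < e.2 ∧ e.2 < f.2)) (fun _ _ => mem_coe.2 (mem_univ _)) ?_
  intro f hf g hg hfg
  obtain ⟨hf, hef⟩ := mem_filter.1 (mem_coe.1 hf)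
  obtain ⟨hg, heg⟩ := mem_filter.1 (mem_coe.1 hg)
  obtain ⟨hf0, hf1, hf2, hf⟩ := mem_sides.1 hf
  obtain ⟨hg0, hg1, hg2, hg⟩ := mem_sides.1 hg
  dsimp only at hfg
  unfold Crosses at hef heg
  split_ifs at hfg with h1 h2 h2
  · rw [decide_eq_decide] at hfg
    by_cases h : f.1 < e.1 ∧ e.1 < f.2
    · have h' := hfg.1 h
      exact eq_of_gaps_meet hf1 hf2 h1 hg1 hg2 h2 h.1.le h.2 h'.1.le h'.2
    · have h' := mt hfg.2 h
      have h3 := hef.resolve_right fun h3 => h ⟨h3.1, h3.2.1⟩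
      have h4 := heg.resolve_right fun h3 => h' ⟨h3.1, h3.2.1⟩
      exact eq_of_gaps_meet hf1 hf2 h1 hg1 hg2 h2 h3.2.1.le h3.2.2 h4.2.1.le h4.2.2
  · have := hg.resolve_left h2
    have h3 := this.2 _ hf1
    have h4 := this.2 _ hf2
    rw [decide_eq_decide] at hfg
    grind
  · have := hf.resolve_left h1
    have h3 := this.2 _ hg1
    have h4 := this.2 _ hg2
    rw [decide_eq_decide] at hfg
    grind
  · have h3 := (hf.resolve_left h1).2
    have h4 := (hg.resolve_left h2).2
    exact Prod.ext (le_antisymm (h3 _ hg1).1 (h4 _ hf1).1)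
      (le_antisymm (h4 _ hf2).2 (h3 _ hg2).2)

open Classical in
/-- The pairs of crossing sides of two polygons. -/
noncomputable def crossings (B C : Finset α) : Finset ((α × α) × (α × α)) :=
  (sides B ×ˢ sides C).filter fun q => Crosses q.1 q.2

lemma card_crossings_comm (B C : Finset α) : (crossings B C).card = (crossings C B).card := by
  refine Finset.card_bij' (fun q _ => q.swap) (fun q _ => q.swap) ?_ ?_ ?_ ?_
  · intro q hq
    simp only [crossings, mem_filter, mem_product] at hq ⊢
    exact ⟨hq.1.symm, Or.symm hq.2⟩
  · intro q hq
    simp only [crossings, mem_filter, mem_product] at hq ⊢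
    exact ⟨hq.1.symm, Or.symm hq.2⟩
  · simp
  · simp

lemma card_crossings_le_mul (B C : Finset α) :
    (crossings B C).card ≤ (sides B).card * (sides C).card := by
  classical
  rw [← card_product]
  exact card_filter_le _ _

lemma card_crossings_le_left (B C : Finset α) :
    (crossings B C).card ≤ 2 * (sides B).card := by
  classical
  refine Finset.card_le_mul_card_image_of_maps_to (f := Prod.fst) ?_ 2 ?_
  · intro q hq
    simp only [crossings, mem_filter, mem_product] at hq
    exact hq.1.1
  · intro e _
    refine le_trans ?_ (card_sides_crosses_le_two C e)
    refine Finset.card_le_card_of_injOn Prod.snd ?_ ?_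
    · intro q hq
      simp only [crossings, coe_filter, mem_filter, mem_product, Set.mem_ofPred_eq] at hq ⊢
      exact ⟨hq.1.1.2, hq.2 ▸ hq.1.2⟩
    · intro q hq q' hq' h
      simp only [coe_filter, Set.mem_ofPred_eq] at hq hq'
      exact Prod.ext (hq.2.trans hq'.2.symm) h

lemma card_crossings_le_right (B C : Finset α) :
    (crossings B C).card ≤ 2 * (sides C).card :=
  card_crossings_comm B C ▸ card_crossings_le_left C B

end Chords

section Weights

/-- Indicator of having at least three elements. -/
def large (p : ℕ) : ℤ := if 3 ≤ p then 1 else 0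

/-- Indicator of having exactly two elements. -/
def isPair (p : ℕ) : ℤ := if p = 2 then 1 else 0

/-- The number of elements beyond the third. -/
def excess (p : ℕ) : ℤ := ((p - 3 : ℕ) : ℤ)

lemma card_crossings_le {α : Type*} [LinearOrder α] (B C : Finset α) :
    ((crossings B C).card : ℤ) ≤
      6 * (large B.card * large C.card) + 2 * (large B.card * isPair C.card)
        + 2 * (isPair B.card * large C.card) + isPair B.card * isPair C.card
        + (large B.card * excess C.card + excess B.card * large C.card) ∧
    ((crossings B C).card : ℤ) ≤
      6 * (large B.card * large C.card) + 2 * (large B.card * isPair C.card)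
        + 2 * (isPair B.card * large C.card) + isPair B.card * isPair C.card
        + 2 * (excess B.card * excess C.card) := by
  have h1 := card_crossings_le_mul B C
  have h2 := card_crossings_le_left B C
  have h3 := card_crossings_le_right B C
  have hB := card_sides_le B
  have hC := card_sides_le C
  have hB' := @card_sides_le_pred _ _ B
  have hC' := @card_sides_le_pred _ _ C
  generalize (crossings B C).card = N at *
  generalize (sides B).card = u at *
  generalize (sides C).card = v at *
  generalize B.card = p at *
  generalize C.card = q at *
  unfold large isPair excess
  rcases lt_or_ge p 3 with hp | hp
  · have hu := hB' hp
    interval_cases p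
    · have : N = 0 := by omega
      subst this
      constructor <;> simp
    · have : N = 0 := by omega
      subst this
      constructor <;> simp
    · rcases lt_or_ge q 3 with hq | hq
      · have hv := hC' hq
        interval_cases q
        · simp; omega
        · simp; omega
        · have : N ≤ 1 := h1.trans (by nlinarith)
          simp; omega
      · have : ¬ q = 2 := by omega
        simp [hq, this]; omega
  · have hp2 : ¬ p = 2 := by omega
    rcases lt_or_ge q 3 with hq | hq
    · have hv := hC' hq
      interval_cases q <;> simp [hp, hp2] <;> omega
    · have hq2 : ¬ q = 2 := by omega
      obtain ⟨a, rfl⟩ := Nat.exists_eq_add_of_le hp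
      obtain ⟨b, rfl⟩ := Nat.exists_eq_add_of_le hq
      simp only [hp, hq, hp2, hq2, if_true, if_false, Nat.add_sub_cancel_left]
      refine ⟨by push_cast; omega, ?_⟩
      rcases Nat.eq_zero_or_pos a with rfl | ha
      · simp; omega
      rcases Nat.eq_zero_or_pos b with rfl | hb
      · simp; omega
      have : (a : ℤ) ≤ a * b := by exact_mod_cast Nat.le_mul_of_pos_right a hb
      omega

lemma sum_offDiag_mul {ι : Type*} [DecidableEq ι] (s : Finset ι) (f g : ι → ℤ) :
    ∑ i ∈ s.offDiag, f i.1 * g i.2 = (∑ i ∈ s, f i) * (∑ i ∈ s, g i) - ∑ i ∈ s, f i * g i := by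
  rw [sum_mul_sum, ← sum_product', ← diag_union_offDiag, sum_union (disjoint_diag_offDiag s),
    sum_diag]
  ring

end Weights

section UpperBound

variable {n : ℕ} (π : Finpartition (univ : Finset (Fin n)))

lemma isChord_iff {a b : Fin n} : IsChord π a b ↔ IsSide (π.part a) (a, b) := by
  constructor
  · rintro ⟨h, B, hB, ha, hb, h'⟩
    rw [π.part_eq_of_mem hB ha]
    exact ⟨h, ha, hb, h'⟩
  · rintro ⟨h, ha, hb, h'⟩
    exact ⟨h, π.part a, π.part_mem.2 (mem_univ a), ha, hb, h'⟩

lemma two_mul_crc_le :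
    2 * crc π ≤ ∑ p ∈ π.parts.offDiag, (crossings p.1 p.2).card := by
  classical
  set S : Finset ((Fin n × Fin n) × (Fin n × Fin n)) := univ.filter fun q =>
    IsChord π q.1.1 q.1.2 ∧ IsChord π q.2.1 q.2.2 ∧
    q.1.1 < q.2.1 ∧ q.2.1 < q.1.2 ∧ q.1.2 < q.2.2 with hS
  have hcrc : crc π = S.card := by
    rw [crc, ← Set.ncard_coe_finset, hS, coe_filter]
    simp
  have hdisj : Disjoint S (S.image Prod.swap) := by
    rw [disjoint_left]
    intro q hq hq'
    obtain ⟨r, hr, rfl⟩ := mem_image.1 hq'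
    simp only [hS, mem_filter, Prod.fst_swap, Prod.snd_swap] at hq hr
    exact lt_asymm hq.2.2.2.1 hr.2.2.2.1
  have hmem : ∀ q ∈ S ∪ S.image Prod.swap,
      IsSide (π.part q.1.1) q.1 ∧ IsSide (π.part q.2.1) q.2 ∧ Crosses q.1 q.2 := by
    intro q hq
    rcases mem_union.1 hq with hq | hq
    · obtain ⟨-, h1, h2, h3⟩ := mem_filter.1 hq
      exact ⟨(isChord_iff π).1 h1, (isChord_iff π).1 h2, Or.inl h3⟩
    · obtain ⟨r, hr, rfl⟩ := mem_image.1 hq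
      obtain ⟨-, h1, h2, h3⟩ := mem_filter.1 hr
      exact ⟨(isChord_iff π).1 h2, (isChord_iff π).1 h1, Or.inr h3⟩
  have hcard : 2 * crc π = (S ∪ S.image Prod.swap).card := by
    rw [card_union_of_disjoint hdisj, card_image_of_injective _ Prod.swap_injective, hcrc, two_mul]
  rw [hcard, card_eq_sum_card_fiberwise (f := fun q => (π.part q.1.1, π.part q.2.1))
    (t := π.parts.offDiag)]
  · refine sum_le_sum fun p _ => card_le_card fun q hq => ?_
    obtain ⟨hqS, rfl⟩ := mem_filter.1 hq
    obtain ⟨h1, h2, h3⟩ := hmem q hqS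
    exact mem_filter.2 ⟨mem_product.2 ⟨mem_sides.2 h1, mem_sides.2 h2⟩, h3⟩
  · intro q hq
    obtain ⟨h1, h2, h3⟩ := hmem q (mem_coe.1 hq)
    refine mem_coe.2 (mem_offDiag.2 ⟨π.part_mem.2 (mem_univ _), π.part_mem.2 (mem_univ _), ?_⟩)
    intro h
    dsimp only at h
    rw [h] at h1
    exact not_crosses_of_isSide h1 h2 h3

/-- Bounds on `cr^c(π)` in terms of the number `k` of blocks with at least three elements, the
number `t` of blocks with two elements, and the excess `r` of the former over triangles. -/
lemma exists_crc_bound : ∃ k t r : ℕ, 3 * k + 2 * t + r ≤ n ∧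
    2 * (crc π : ℤ) ≤ 6 * (k ^ 2 - k) + 4 * (k * t) + (t ^ 2 - t) + 2 * (k * r - r) ∧
    2 * (crc π : ℤ) ≤ 6 * (k ^ 2 - k) + 4 * (k * t) + (t ^ 2 - t) + 2 * (r ^ 2 - r) := by
  have hcrc : 2 * (crc π : ℤ) ≤ ∑ p ∈ π.parts.offDiag, ((crossings p.1 p.2).card : ℤ) := by
    exact_mod_cast two_mul_crc_le π
  have hk : 0 ≤ ∑ B ∈ π.parts, large B.card :=
    sum_nonneg fun B _ => by unfold large; split_ifs <;> norm_num
  have ht : 0 ≤ ∑ B ∈ π.parts, isPair B.card :=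
    sum_nonneg fun B _ => by unfold isPair; split_ifs <;> norm_num
  have hr : 0 ≤ ∑ B ∈ π.parts, excess B.card :=
    sum_nonneg fun B _ => by unfold excess; positivity
  have hn : 3 * ∑ B ∈ π.parts, large B.card + 2 * ∑ B ∈ π.parts, isPair B.card
      + ∑ B ∈ π.parts, excess B.card ≤ (n : ℤ) := by
    have h := π.sum_card_parts
    rw [card_univ, Fintype.card_fin] at h
    rw [mul_sum, mul_sum, ← sum_add_distrib, ← sum_add_distrib]
    calc _ ≤ ∑ B ∈ π.parts, (B.card : ℤ) := sum_le_sum fun B _ => by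
          unfold large isPair excess; split_ifs <;> omega
      _ = n := by exact_mod_cast h
  have hxx : ∑ B ∈ π.parts, large B.card * large B.card = ∑ B ∈ π.parts, large B.card :=
    sum_congr rfl fun B _ => by unfold large; split_ifs <;> norm_num
  have hyy : ∑ B ∈ π.parts, isPair B.card * isPair B.card = ∑ B ∈ π.parts, isPair B.card :=
    sum_congr rfl fun B _ => by unfold isPair; split_ifs <;> norm_num
  have hxy : ∑ B ∈ π.parts, large B.card * isPair B.card = 0 :=
    sum_eq_zero fun B _ => by unfold large isPair; split_ifs <;> omega
  have hyx : ∑ B ∈ π.parts, isPair B.card * large B.card = 0 :=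
    sum_eq_zero fun B _ => by unfold large isPair; split_ifs <;> omega
  have hxr : ∑ B ∈ π.parts, large B.card * excess B.card = ∑ B ∈ π.parts, excess B.card :=
    sum_congr rfl fun B _ => by unfold large excess; split_ifs <;> omega
  have hrx : ∑ B ∈ π.parts, excess B.card * large B.card = ∑ B ∈ π.parts, excess B.card :=
    sum_congr rfl fun B _ => by unfold large excess; split_ifs <;> omega
  have hrr : ∑ B ∈ π.parts, excess B.card ≤ ∑ B ∈ π.parts, excess B.card * excess B.card :=
    sum_le_sum fun B _ => by unfold excess; exact_mod_cast Nat.le_mul_self _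
  have h1 := hcrc.trans (sum_le_sum fun p _ => (card_crossings_le p.1 p.2).1)
  have h2 := hcrc.trans (sum_le_sum fun p _ => (card_crossings_le p.1 p.2).2)
  simp only [sum_add_distrib, ← mul_sum] at h1 h2
  rw [sum_offDiag_mul π.parts (fun B => large B.card) (fun B => large B.card),
    sum_offDiag_mul π.parts (fun B => large B.card) (fun B => isPair B.card),
    sum_offDiag_mul π.parts (fun B => isPair B.card) (fun B => large B.card),
    sum_offDiag_mul π.parts (fun B => isPair B.card) (fun B => isPair B.card)] at h1 h2
  rw [sum_offDiag_mul π.parts (fun B => large B.card) (fun B => excess B.card),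
    sum_offDiag_mul π.parts (fun B => excess B.card) (fun B => large B.card)] at h1
  rw [sum_offDiag_mul π.parts (fun B => excess B.card) (fun B => excess B.card)] at h2
  rw [hxx, hxy, hyx, hyy, hxr, hrx] at h1
  rw [hxx, hxy, hyx, hyy] at h2
  generalize ∑ B ∈ π.parts, excess B.card * excess B.card = w at *
  generalize ∑ B ∈ π.parts, large B.card = k at *
  generalize ∑ B ∈ π.parts, isPair B.card = t at *
  generalize ∑ B ∈ π.parts, excess B.card = r at *
  lift k to ℕ using hk
  lift t to ℕ using ht
  lift r to ℕ using hr
  exact ⟨k, t, r, by omega, by linarith, by linarith⟩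

end UpperBound

lemma two_mul_succ_choose_two (m : ℕ) : 2 * (m + 1).choose 2 = (m + 1) * m := by
  rw [Nat.choose_two_right, Nat.mul_div_cancel' (Nat.even_mul_pred_self _).two_dvd,
    Nat.add_sub_cancel]

/-- The claimed maximum, with `n = 3 * K + e`. -/
lemma max_value_eq {n K e : ℕ} (hn : n = 3 * K + e) (he : e < 3) (hK : 1 ≤ K) :
    (((if n % 3 = 0 then 2 * (n - 1).choose 2 / 3 else 2 * (n - 2).choose 2 / 3 : ℕ)) : ℤ) =
      3 * (K * (K - 1)) + if e = 2 then 2 * (K : ℤ) else 0 := by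
  obtain ⟨J, rfl⟩ := Nat.exists_eq_add_of_le hK
  have hmod : n % 3 = e := by omega
  rw [hmod]
  interval_cases e
  · have : n - 1 = (3 * J + 1) + 1 := by omega
    simp only [if_true, this, two_mul_succ_choose_two]
    rw [show (3 * J + 1 + 1) * (3 * J + 1) = 2 + 3 * (3 * J * J + 3 * J) by ring]
    norm_num [Nat.add_mul_div_left]
    ring
  · have : n - 2 = (3 * J + 1) + 1 := by omega
    simp only [this, two_mul_succ_choose_two]
    rw [show (3 * J + 1 + 1) * (3 * J + 1) = 2 + 3 * (3 * J * J + 3 * J) by ring]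
    norm_num [Nat.add_mul_div_left]
    ring
  · have : n - 2 = (3 * J + 2) + 1 := by omega
    simp only [this, two_mul_succ_choose_two]
    rw [show (3 * J + 2 + 1) * (3 * J + 2) = 3 * ((J + 1) * (3 * J + 2)) by ring]
    norm_num
    ring

lemma bound_le_max_value {K e k t r c : ℤ} (he0 : 0 ≤ e) (he : e < 3)
    (h5 : 5 ≤ 3 * K + e) (hk : 0 ≤ k) (ht : 0 ≤ t) (hr : 0 ≤ r)
    (hn : 3 * k + 2 * t + r ≤ 3 * K + e)
    (h1 : 2 * c ≤ 6 * (k ^ 2 - k) + 4 * (k * t) + (t ^ 2 - t) + 2 * (k * r - r))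
    (h2 : 2 * c ≤ 6 * (k ^ 2 - k) + 4 * (k * t) + (t ^ 2 - t) + 2 * (r ^ 2 - r)) :
    c ≤ 3 * (K * (K - 1)) + if e = 2 then 2 * K else 0 := by
  obtain ⟨j, rfl⟩ : ∃ j, K = k + j := ⟨K - k, by ring⟩
  have hj : 0 ≤ j := by omega
  have hkr : k * r ≤ k * (3 * j + e - 2 * t) := mul_le_mul_of_nonneg_left (by omega) hk
  rcases hj.eq_or_lt with rfl | hj0
  · obtain rfl | rfl : t = 0 ∨ t = 1 := by omega
    · obtain rfl | rfl | rfl : r = 0 ∨ r = 1 ∨ r = 2 := by omega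
      · split_ifs <;> nlinarith
      · split_ifs <;> nlinarith
      · have : e = 2 := by omega
        rw [if_pos this]
        nlinarith
    · have : e = 2 := by omega
      rw [if_pos this]
      nlinarith
  · have hkj : k ≤ k * j := le_mul_of_one_le_right hk hj0
    have hrest : t ^ 2 - t ≤ 6 * (j ^ 2 - j) + (if e = 2 then 4 * j else 0)
        + (if e = 1 then 4 * k else 0) := by
      obtain rfl | hj2 : j = 1 ∨ 2 ≤ j := by omega
      · have : t ≤ 2 := by omega
        interval_cases t <;> split_ifs <;> omega
      · have ht2 : 2 * t ≤ 3 * j + 2 := by omega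
        have : 8 * (t ^ 2 - t) ≤ 2 * ((3 * j + 2) * (3 * j)) := by nlinarith
        split_ifs <;> nlinarith
    obtain rfl | rfl | rfl : e = 0 ∨ e = 1 ∨ e = 2 := by omega
    all_goals
      norm_num at hrest ⊢
      nlinarith

section LowerBound

/-- The colouring of `{0, …, 3 * L}` by residues modulo `L`, except that `3 * L` has a colour of
its own. -/
def colour (L i : ℕ) : ℕ :=
  if i < L then i else if i < 2 * L then i - L else if i < 3 * L then i - 2 * L else L

open Classical in
/-- The set partition of `[n]` into colour classes. -/
noncomputable def colourPartition (n L : ℕ) : Finpartition (univ : Finset (Fin n)) :=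
  Finpartition.ofSetoid (Setoid.ker fun i : Fin n => colour L i)

lemma isChord_colourPartition {n L : ℕ} {a b : Fin n} (hab : a < b)
    (hc : colour L a = colour L b)
    (h : (∀ c : Fin n, colour L a = colour L c → ¬(a < c ∧ c < b)) ∨
      ((∃ m : Fin n, colour L a = colour L m ∧ a < m ∧ m < b) ∧
        ∀ c : Fin n, colour L a = colour L c → a ≤ c ∧ c ≤ b)) :
    IsChord (colourPartition n L) a b := by
  classical
  have hmem : ∀ c, c ∈ (colourPartition n L).part a ↔ colour L a = colour L c := fun c =>
    Finpartition.mem_part_ofSetoid_iff_rel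
  refine ⟨hab, (colourPartition n L).part a, Finpartition.part_mem _ |>.2 (mem_univ a),
    (hmem a).2 rfl, (hmem b).2 hc, ?_⟩
  rcases h with h | ⟨⟨m, hm, ham, hmb⟩, h⟩
  · exact Or.inl fun c hc => h c ((hmem c).1 hc)
  · refine Or.inr ⟨?_, fun c hc => h c ((hmem c).1 hc)⟩
    rw [← card_eq_three.2 ⟨a, m, b, ham.ne, hab.ne, hmb.ne, rfl⟩]
    refine card_le_card fun c hc' => (hmem c).2 ?_
    simp only [mem_insert, mem_singleton] at hc'
    rcases hc' with rfl | rfl | rfl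
    · rfl
    · exact hm
    · exact hc

variable {n L : ℕ}

lemma isChord_first {c : ℕ} (hc : c < L) (hn : c + L < n) :
    IsChord (colourPartition n L) ⟨c, by omega⟩ ⟨c + L, hn⟩ := by
  refine isChord_colourPartition (Fin.lt_def.2 (by dsimp only; omega)) ?_
    (Or.inl fun d hd h => ?_)
  · unfold colour; dsimp only; split_ifs <;> omega
  · rw [Fin.lt_def, Fin.lt_def] at h
    unfold colour at hd; dsimp only at hd h; split_ifs at hd <;> omega

lemma isChord_second {c : ℕ} (hc : c < L) (hn : c + 2 * L < n) :
    IsChord (colourPartition n L) ⟨c + L, by omega⟩ ⟨c + 2 * L, hn⟩ := by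
  refine isChord_colourPartition (Fin.lt_def.2 (by dsimp only; omega)) ?_
    (Or.inl fun d hd h => ?_)
  · unfold colour; dsimp only; split_ifs <;> omega
  · rw [Fin.lt_def, Fin.lt_def] at h
    unfold colour at hd; dsimp only at hd h; split_ifs at hd <;> omega

lemma isChord_long {c : ℕ} (hc : c < L) (hn : c + 2 * L < n) :
    IsChord (colourPartition n L) ⟨c, by omega⟩ ⟨c + 2 * L, hn⟩ := by
  refine isChord_colourPartition (Fin.lt_def.2 (by dsimp only; omega)) ?_
    (Or.inr ⟨⟨⟨c + L, by omega⟩, ?_, Fin.lt_def.2 ?_, Fin.lt_def.2 ?_⟩, fun d hd => ?_⟩)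
  · unfold colour; dsimp only; split_ifs <;> omega
  · unfold colour; dsimp only; split_ifs <;> omega
  · dsimp only; omega
  · dsimp only; omega
  · rw [Fin.le_def, Fin.le_def]
    unfold colour at hd; dsimp only at hd ⊢; split_ifs at hd <;> omega

/-- The six crossings of the triangles `a, a + L, a + 2 * L` and `b, b + L, b + 2 * L`, the first
two of which do not involve the vertex `b + 2 * L`. -/
def triangleCrossing (L : ℕ) (x : ℕ × (_ : ℕ) × ℕ) : (ℕ × ℕ) × (ℕ × ℕ) :=
  let b := x.2.1
  let a := x.2.2
  match x.1 with
  | 0 => ((a, a + L), (b, b + L))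
  | 1 => ((b, b + L), (a + L, a + 2 * L))
  | 2 => ((a + L, a + 2 * L), (b + L, b + 2 * L))
  | 3 => ((a, a + 2 * L), (b, b + 2 * L))
  | 4 => ((a, a + 2 * L), (b + L, b + 2 * L))
  | _ => ((a, a + L), (b, b + 2 * L))

lemma le_crc_colourPartition {M : ℕ} (hn : 3 * L - 1 ≤ n) (hML : M ≤ L) (hM : M + 2 * L ≤ n) :
    2 * L.choose 2 + 4 * M.choose 2 ≤ crc (colourPartition n L) := by
  set P : ℕ → Finset ((_ : ℕ) × ℕ) := fun m => (range m).sigma range with hP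
  have hPcard : ∀ m, (P m).card = m.choose 2 := fun m => by
    simp [hP, card_sigma, sum_range_id, Nat.choose_two_right]
  set I := range 2 ×ˢ P L ∪ Ico 2 6 ×ˢ P M with hI
  have hIcard : I.card = 2 * L.choose 2 + 4 * M.choose 2 := by
    rw [hI, card_union_of_disjoint, card_product, card_product, hPcard, hPcard]
    · simp
    · rw [disjoint_left]
      intro x hx hy
      simp only [mem_product, mem_range, mem_Ico] at hx hy
      omega
  have hmem : ∀ t b a, (⟨t, b, a⟩ : ℕ × (_ : ℕ) × ℕ) ∈ I →
      a < b ∧ b < L ∧ t < 6 ∧ (t < 2 ∨ b < M) := by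
    intro t b a h
    simp only [hI, hP, mem_union, mem_product, mem_range, mem_Ico, mem_sigma] at h
    omega
  have hinj : Set.InjOn (triangleCrossing L) I := by
    rintro ⟨t, b, a⟩ hx ⟨t', b', a'⟩ hx' h
    obtain ⟨h1, h2, h3, -⟩ := hmem t b a (mem_coe.1 hx)
    obtain ⟨h1', h2', h3', -⟩ := hmem t' b' a' (mem_coe.1 hx')
    suffices t = t' ∧ b = b' ∧ a = a' by
      obtain ⟨rfl, rfl, rfl⟩ := this
      rfl
    clear hx hx'
    interval_cases t <;> interval_cases t' <;>
      simp only [triangleCrossing, Prod.mk.injEq] at h <;> omega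
  let v : (Fin n × Fin n) × (Fin n × Fin n) → (ℕ × ℕ) × (ℕ × ℕ) :=
    fun q => ((q.1.1, q.1.2), (q.2.1, q.2.2))
  rw [← hIcard, crc, ← card_image_of_injOn hinj, ← Set.ncard_coe_finset]
  refine le_trans (Set.ncard_le_ncard ?_ (Set.toFinite _)) (Set.ncard_image_le (f := v))
  intro y hy
  obtain ⟨⟨t, b, a⟩, hx, rfl⟩ := mem_image.1 (mem_coe.1 hy)
  obtain ⟨h1, h2, h3, h4⟩ := hmem t b a hx
  clear hx hy
  have lift_mem : ∀ p q r s : ℕ, (hpr : p < r) → (hrq : r < q) → (hqs : q < s) → (hs : s < n) →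
      IsChord (colourPartition n L) ⟨p, by omega⟩ ⟨q, by omega⟩ →
      IsChord (colourPartition n L) ⟨r, by omega⟩ ⟨s, hs⟩ →
      ((p, q), (r, s)) ∈ v '' {q : (Fin n × Fin n) × (Fin n × Fin n) |
        IsChord (colourPartition n L) q.1.1 q.1.2 ∧ IsChord (colourPartition n L) q.2.1 q.2.2 ∧
        q.1.1 < q.2.1 ∧ q.2.1 < q.1.2 ∧ q.1.2 < q.2.2} := by
    intro p q r s hpr hrq hqs hs hpq hrs
    exact ⟨((⟨p, by omega⟩, ⟨q, by omega⟩), (⟨r, by omega⟩, ⟨s, hs⟩)),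
      ⟨hpq, hrs, Fin.lt_def.2 hpr, Fin.lt_def.2 hrq, Fin.lt_def.2 hqs⟩, rfl⟩
  interval_cases t <;> simp only [triangleCrossing]
  · exact lift_mem _ _ _ _ (by omega) (by omega) (by omega) (by omega)
      (isChord_first (by omega) (by omega)) (isChord_first (by omega) (by omega))
  · exact lift_mem _ _ _ _ (by omega) (by omega) (by omega) (by omega)
      (isChord_first (by omega) (by omega)) (isChord_second (by omega) (by omega))
  · exact lift_mem _ _ _ _ (by omega) (by omega) (by omega) (by omega)
      (isChord_second (by omega) (by omega)) (isChord_second (by omega) (by omega))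
  · exact lift_mem _ _ _ _ (by omega) (by omega) (by omega) (by omega)
      (isChord_long (by omega) (by omega)) (isChord_long (by omega) (by omega))
  · exact lift_mem _ _ _ _ (by omega) (by omega) (by omega) (by omega)
      (isChord_long (by omega) (by omega)) (isChord_second (by omega) (by omega))
  · exact lift_mem _ _ _ _ (by omega) (by omega) (by omega) (by omega)
      (isChord_first (by omega) (by omega)) (isChord_long (by omega) (by omega))

end LowerBound

/-- The maximum value of the circular crossing number on `Π_n` for `n ≥ 5`. -/
theorem max_crc (n : ℕ) (hn : 5 ≤ n) :
    IsGreatest {c : ℕ | ∃ π : Finpartition (univ : Finset (Fin n)), crc π = c}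
      (if n % 3 = 0 then 2 * (n - 1).choose 2 / 3 else 2 * (n - 2).choose 2 / 3) := by
  obtain ⟨K, e, hne, he⟩ : ∃ K e, n = 3 * K + e ∧ e < 3 := ⟨n / 3, n % 3, by omega, by omega⟩
  have hval := max_value_eq hne he (by omega)
  have upper : ∀ π : Finpartition (univ : Finset (Fin n)),
      crc π ≤ if n % 3 = 0 then 2 * (n - 1).choose 2 / 3 else 2 * (n - 2).choose 2 / 3 := by
    intro π
    obtain ⟨k, t, r, hktr, h1, h2⟩ := exists_crc_bound π
    have := bound_le_max_value (K := K) (e := e) (by omega) (by omega)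
      (by omega) (Nat.cast_nonneg k) (Nat.cast_nonneg t) (Nat.cast_nonneg r) (by omega) h1 h2
    have he2 : (e : ℤ) = 2 ↔ e = 2 := by omega
    simp only [he2] at this
    rwa [← Nat.cast_le (α := ℤ), hval]
  have choose_eq : ∀ m : ℕ, 2 * (m.choose 2 : ℤ) = m * (m - 1) := fun m => by
    rcases m with _ | m
    · simp
    · rw [← Nat.cast_two, ← Nat.cast_mul, two_mul_succ_choose_two]
      push_cast
      ring
  have hK := choose_eq K
  refine ⟨?_, by rintro _ ⟨π, rfl⟩; exact upper π⟩
  by_cases he2 : e = 2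
  · refine ⟨colourPartition n (K + 1), (upper _).antisymm ?_⟩
    have hK1 := choose_eq (K + 1)
    have := le_crc_colourPartition (n := n) (L := K + 1) (M := K) (by omega) (by omega) (by omega)
    rw [← Nat.cast_le (α := ℤ), hval, if_pos he2]
    zify at this
    push_cast at hK1
    linarith
  · refine ⟨colourPartition n K, (upper _).antisymm ?_⟩
    have := le_crc_colourPartition (n := n) (L := K) (M := K) (by omega) le_rfl (by omega)
    rw [← Nat.cast_le (α := ℤ), hval, if_neg he2]
    zify at this
    linarith
end

section
/- For all integers n ≥ k ≥ 1, the second factorial moment sum of the linear crossing number satisfies Σ_{π∈Π_n^k} cr^ℓ(π)·(cr^ℓ(π)−1) = ((k−1)²/4)·n²·S(n,k) − ((k−1)/12)·(15k²−16k+5)·n·S(n,k) + (k(k−1)/144)·(225k²−229k+170)·S(n,k) + (1/12)·((18k−33)·n² − (63k²−137k+79)·n + (k−1)(45k²−73k+20))·S(n,k−1) + (1/12)·(27n² − (54k−55)·n + (k−2)(27k−1))·S(n,k−2). -/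
open Finset

/-- The generalized binomial coefficient `x.choose h` for real `x`. -/
noncomputable def realChoose (x : ℝ) : ℕ → ℝ
  | 0 => 1
  | h + 1 => realChoose x h * (x - h) / (h + 1)

theorem realChoose_succ (x : ℝ) (h : ℕ) :
    ((h : ℝ) + 1) * realChoose x (h + 1) = (x - h) * realChoose x h := by
  rw [realChoose]
  field_simp

theorem mul_realChoose_sub_one (x : ℝ) (h : ℕ) :
    x * realChoose (x - 1) h = (x - h) * realChoose x h := by
  induction h with
  | zero => simp [realChoose]
  | succ h ih =>
    simp only [realChoose]
    push_cast
    field_simp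
    linear_combination (x - 1 - h) * ih

theorem natCast_mul_realChoose (x : ℝ) (h : ℕ) :
    h * realChoose x h = x * (realChoose x h - realChoose (x - 1) h) := by
  linear_combination mul_realChoose_sub_one x h

theorem succ_mul_realChoose_succ (x : ℝ) (h : ℕ) :
    ((h : ℝ) + 1) * realChoose x (h + 1) = x * realChoose (x - 1) h := by
  rw [realChoose_succ, mul_realChoose_sub_one]

theorem succ_mul_self_mul_realChoose_succ (x : ℝ) (h : ℕ) :
    ((h : ℝ) + 1) * h * realChoose x (h + 1) =
      x * (x - 1) * (realChoose (x - 1) h - realChoose (x - 2) h) := by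
  have h₁ := natCast_mul_realChoose (x - 1) h
  rw [show x - 1 - 1 = x - 2 by ring] at h₁
  linear_combination h * succ_mul_realChoose_succ x h + x * h₁

theorem succ_mul_self_mul_pred_mul_realChoose_succ (x : ℝ) (h : ℕ) :
    ((h : ℝ) + 1) * h * (h - 1) * realChoose x (h + 1) =
      x * (x - 1) * (x - 2) *
        (realChoose (x - 1) h - 2 * realChoose (x - 2) h + realChoose (x - 3) h) := by
  have h₁ := natCast_mul_realChoose (x - 1) h
  have h₂ := natCast_mul_realChoose (x - 2) h
  rw [show x - 1 - 1 = x - 2 by ring] at h₁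
  rw [show x - 2 - 1 = x - 3 by ring] at h₂
  linear_combination (h - 1) * succ_mul_self_mul_realChoose_succ x h
    + x * (x - 1) * (h₁ - h₂)

theorem realChoose_pascal (x : ℝ) (h : ℕ) :
    realChoose x (h + 1) = realChoose (x - 1) h + realChoose (x - 1) (h + 1) := by
  induction h with
  | zero => simp [realChoose]
  | succ h ih =>
    have h₁ := realChoose_succ x (h + 1)
    have h₂ := realChoose_succ (x - 1) (h + 1)
    have h₃ := realChoose_succ (x - 1) h
    have h₄ : ((h : ℝ) + 2) ≠ 0 := by positivity
    push_cast at h₁ h₂ h₃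
    apply mul_left_cancel₀ h₄
    linear_combination h₁ - h₂ + (x - h - 1) * ih - h₃

/-- Stirling numbers of the second kind with the second argument an arbitrary real number. -/
noncomputable def realStirling : ℕ → ℝ → ℝ
  | 0, x => if x = 0 then 1 else 0
  | n + 1, x => realStirling n (x - 1) + x * realStirling n x

section ClosedForm

/-- Coefficient of `(1 + x) ^ k` in the first-order generating function. -/
noncomputable def firstTop (n : ℕ) (k : ℝ) : ℝ :=
  ((k - 1) / 2 * n - 3 / 4 * k * (k - 1)) * realStirling n k
    + (n - k + 1) / 2 * realStirling n (k - 1)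

/-- Coefficient of `(1 + x) ^ (k - 1)` in the first-order generating function. -/
noncomputable def firstMid (n : ℕ) (k : ℝ) : ℝ :=
  -(k * (k - 1) / 2) * realStirling n k + (n - k + 1) * realStirling n (k - 1)

/-- Coefficient of `(1 + x) ^ k` in the second-order generating function. -/
noncomputable def secondTop (n : ℕ) (k : ℝ) : ℝ :=
  ((-49/72)*k + (61/48)*k^2 + (-83/72)*k^3 + (9/16)*k^4
      + (5/12 - (5/4)*k + (19/12)*k^2 - (3/4)*k^3)*n
      + (1/4 - (1/2)*k + (1/4)*k^2)*n^2) * realStirling n k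
    + (-2/3 + (7/4)*k - (11/6)*k^2 + (3/4)*k^3
      + (-19/12 + (29/12)*k - (5/4)*k^2)*n + (-3/4 + (1/2)*k)*n^2) * realStirling n (k - 1)
    + (1/6 - (7/12)*k + (1/4)*k^2 + (7/12 - (1/2)*k)*n + (1/4)*n^2) * realStirling n (k - 2)

/-- Coefficient of `(1 + x) ^ (k - 1)` in the second-order generating function. -/
noncomputable def secondMid (n : ℕ) (k : ℝ) : ℝ :=
  ((-1/3)*k + (3/4)*k^2 - (7/6)*k^3 + (3/4)*k^4
      + (-(1/2)*k + k^2 - (1/2)*k^3)*n) * realStirling n k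
    + (1 + k - 4*k^2 + 2*k^3 + (-3 + 6*k - 3*k^2)*n + (-2 + k)*n^2) * realStirling n (k - 1)
    + (-2 - k + k^2 + (1 - 2*k)*n + n^2) * realStirling n (k - 2)

/-- Coefficient of `(1 + x) ^ (k - 2)` in the second-order generating function. -/
noncomputable def secondBot (n : ℕ) (k : ℝ) : ℝ :=
  ((-1/6)*k + (3/4)*k^2 - (5/6)*k^3 + (1/4)*k^4) * realStirling n k
    + (-2 + 5*k - 4*k^2 + k^3 + (-2 + 3*k - k^2)*n) * realStirling n (k - 1)
    + (2 - 3*k + k^2 + (3 - 2*k)*n + n^2) * realStirling n (k - 2)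

variable (n : ℕ) (k : ℝ)

theorem firstTop_succ : firstTop (n + 1) k =
    firstTop n (k - 1) + k * firstTop n k + k * (k - 1) / 2 * realStirling n k := by
  simp only [firstTop, realStirling, show k - 1 - 1 = k - 2 by ring]
  push_cast
  ring

theorem firstMid_succ : firstMid (n + 1) k =
    firstMid n (k - 1) + (k - 1) * firstMid n k - k * (k - 1) / 2 * realStirling n k := by
  simp only [firstMid, realStirling, show k - 1 - 1 = k - 2 by ring]
  push_cast
  ring

theorem secondTop_succ : secondTop (n + 1) k =
    secondTop n (k - 1) + k * secondTop n k + k * (k - 1) * firstTop n k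
      + k * (k - 1) * (k - 2) / 3 * realStirling n k := by
  simp only [secondTop, firstTop, realStirling, show k - 1 - 1 = k - 2 by ring,
    show k - 1 - 2 = k - 3 by ring, show k - 2 - 1 = k - 3 by ring]
  push_cast
  ring

theorem secondMid_succ : secondMid (n + 1) k =
    secondMid n (k - 1) + (k - 1) * secondMid n k - k * (k - 1) * firstTop n k
      + (k - 1) * (k - 2) * firstMid n k
      - 2 * k * (k - 1) * (k - 2) / 3 * realStirling n k := by
  simp only [secondMid, firstTop, firstMid, realStirling, show k - 1 - 1 = k - 2 by ring,
    show k - 1 - 2 = k - 3 by ring, show k - 2 - 1 = k - 3 by ring]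
  push_cast
  ring

theorem secondBot_succ : secondBot (n + 1) k =
    secondBot n (k - 1) + (k - 2) * secondBot n k - (k - 1) * (k - 2) * firstMid n k
      + k * (k - 1) * (k - 2) / 3 * realStirling n k := by
  simp only [secondBot, firstMid, realStirling, show k - 1 - 1 = k - 2 by ring,
    show k - 1 - 2 = k - 3 by ring, show k - 2 - 1 = k - 3 by ring]
  push_cast
  ring

theorem first_zero : firstTop 0 k = 0 ∧ firstMid 0 k = 0 := by
  simp only [firstTop, firstMid, realStirling]
  constructor <;> split_ifs with h₁ h₂ <;> push_cast <;> (try subst h₁) <;> grind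

theorem second_zero : secondTop 0 k = 0 ∧ secondMid 0 k = 0 ∧ secondBot 0 k = 0 := by
  simp only [secondTop, secondMid, secondBot, realStirling]
  refine ⟨?_, ?_, ?_⟩ <;> split_ifs <;> push_cast <;> grind

end ClosedForm

section Recurrence

open Polynomial

theorem eval_one_geom (m : ℕ) : (∑ i ∈ range m, (X : ℝ[X]) ^ i).eval 1 = m := by
  simp [eval_finsetSum]

theorem eval_one_derivative_geom (m : ℕ) :
    (derivative (∑ i ∈ range m, (X : ℝ[X]) ^ i)).eval 1 = (m : ℝ) * (m - 1) / 2 := by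
  induction m with
  | zero => simp
  | succ m ih =>
    rw [sum_range_succ, derivative_add, eval_add, ih]
    simp [derivative_X_pow]
    ring

theorem eval_one_derivative_two_geom (m : ℕ) :
    (derivative (derivative (∑ i ∈ range m, (X : ℝ[X]) ^ i))).eval 1 =
      (m : ℝ) * (m - 1) * (m - 2) / 3 := by
  induction m with
  | zero => simp
  | succ m ih =>
    rw [sum_range_succ, derivative_add, derivative_add, eval_add, ih]
    rcases m with _ | m
    · simp
    · simp [derivative_X_pow]
      ring

/-- The recurrence, in the number of points, satisfied by the crossing polynomials `A n k h`
of partitions of `[n]` with `k` blocks, `h` of which are marked as open. -/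
structure IsOpenCrossingPoly (A : ℕ → ℝ → ℕ → ℝ[X]) : Prop where
  zero : ∀ k h, A 0 k h = if k = 0 ∧ h = 0 then 1 else 0
  succ_zero : ∀ n k, A (n + 1) k 0 =
    A n (k - 1) 0 + (∑ i ∈ range (0 + 1), X ^ i) * A n k (0 + 1)
  succ_succ : ∀ n k h, A (n + 1) k (h + 1) =
    (A n (k - 1) h + (∑ i ∈ range (h + 1), X ^ i) * A n k (h + 1)) +
    (A n (k - 1) (h + 1) + (∑ i ∈ range (h + 1 + 1), X ^ i) * A n k (h + 1 + 1))

variable {A : ℕ → ℝ → ℕ → ℝ[X]}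

theorem IsOpenCrossingPoly.eval_one (hA : IsOpenCrossingPoly A) (n : ℕ) (k : ℝ) (h : ℕ) :
    (A n k h).eval 1 = realStirling n k * realChoose k h := by
  induction n generalizing k h with
  | zero =>
    rw [hA.zero, realStirling]
    rcases h with _ | h
    · split_ifs <;> simp_all [realChoose]
    · by_cases hk : k = 0
      · subst hk
        have := succ_mul_realChoose_succ 0 h
        have h₀ : (h : ℝ) + 1 ≠ 0 := by positivity
        simp_all
      · simp [hk]
  | succ n ih =>
    have step (h : ℕ) :
        (A n (k - 1) h + (∑ i ∈ range (h + 1), X ^ i) * A n k (h + 1)).eval 1 =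
          realStirling (n + 1) k * realChoose (k - 1) h := by
      simp only [eval_add, eval_mul, eval_one_geom, ih, realStirling]
      push_cast
      linear_combination realStirling n k * succ_mul_realChoose_succ k h
    rcases h with _ | h
    · rw [hA.succ_zero, step]
      simp [realChoose]
    · rw [hA.succ_succ, eval_add, step, step, realChoose_pascal k]
      ring

theorem IsOpenCrossingPoly.eval_one_derivative (hA : IsOpenCrossingPoly A)
    (n : ℕ) (k : ℝ) (h : ℕ) :
    (derivative (A n k h)).eval 1 =
      firstTop n k * realChoose k h + firstMid n k * realChoose (k - 1) h := by
  induction n generalizing k h with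
  | zero =>
    rw [hA.zero, (first_zero k).1, (first_zero k).2]
    split_ifs <;> simp
  | succ n ih =>
    have step (h : ℕ) :
        (derivative
          (A n (k - 1) h + (∑ i ∈ range (h + 1), X ^ i) * A n k (h + 1))).eval 1 =
          firstTop (n + 1) k * realChoose (k - 1) h
            + firstMid (n + 1) k * realChoose (k - 1 - 1) h := by
      simp only [derivative_add, derivative_mul, eval_add, eval_mul, eval_one_geom,
        eval_one_derivative_geom, ih, hA.eval_one, firstTop_succ, firstMid_succ]
      have h₁ := succ_mul_realChoose_succ (k - 1) h
      have h₂ := succ_mul_self_mul_realChoose_succ k h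
      rw [show k - 1 - 1 = k - 2 by ring] at *
      push_cast
      linear_combination firstTop n k * succ_mul_realChoose_succ k h + firstMid n k * h₁
        + realStirling n k / 2 * h₂
    rcases h with _ | h
    · rw [hA.succ_zero, step]
      simp [realChoose]
    · rw [hA.succ_succ, derivative_add, eval_add, step, step, realChoose_pascal k,
        realChoose_pascal (k - 1)]
      ring

theorem IsOpenCrossingPoly.eval_one_derivative_two (hA : IsOpenCrossingPoly A)
    (n : ℕ) (k : ℝ) (h : ℕ) :
    (derivative (derivative (A n k h))).eval 1 =
      secondTop n k * realChoose k h + secondMid n k * realChoose (k - 1) h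
        + secondBot n k * realChoose (k - 2) h := by
  induction n generalizing k h with
  | zero =>
    rw [hA.zero, (second_zero k).1, (second_zero k).2.1, (second_zero k).2.2]
    split_ifs <;> simp
  | succ n ih =>
    have step (h : ℕ) :
        (derivative (derivative
          (A n (k - 1) h + (∑ i ∈ range (h + 1), X ^ i) * A n k (h + 1)))).eval 1 =
          secondTop (n + 1) k * realChoose (k - 1) h
            + secondMid (n + 1) k * realChoose (k - 1 - 1) h
            + secondBot (n + 1) k * realChoose (k - 2 - 1) h := by
      simp only [derivative_add, derivative_mul, eval_add, eval_mul, eval_one_geom,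
        eval_one_derivative_geom, eval_one_derivative_two_geom, ih, hA.eval_one,
        hA.eval_one_derivative, secondTop_succ, secondMid_succ, secondBot_succ]
      have h₁ := succ_mul_realChoose_succ (k - 1) h
      have h₂ := succ_mul_realChoose_succ (k - 2) h
      have h₃ := succ_mul_self_mul_realChoose_succ k h
      have h₄ := succ_mul_self_mul_realChoose_succ (k - 1) h
      have h₅ := succ_mul_self_mul_pred_mul_realChoose_succ k h
      rw [show k - 1 - 1 = k - 2 by ring] at *
      rw [show k - 1 - 2 = k - 3 by ring] at *
      rw [show k - 2 - 1 = k - 3 by ring] at *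
      push_cast
      linear_combination secondTop n k * succ_mul_realChoose_succ k h + secondMid n k * h₁
        + secondBot n k * h₂ + firstTop n k * h₃ + firstMid n k * h₄
        + realStirling n k / 3 * h₅
    rcases h with _ | h
    · rw [hA.succ_zero, step]
      simp [realChoose]
    · rw [hA.succ_succ, derivative_add, derivative_add, eval_add, step, step,
        realChoose_pascal k, realChoose_pascal (k - 1), realChoose_pascal (k - 2)]
      ring

end Recurrence

section Weight

open Polynomial

/-- The number of arcs in `E` passing strictly over the point `c`. -/
def coverNum (E : Finset (ℕ × ℕ)) (c : ℕ) : ℕ := #{p ∈ E | p.1 < c ∧ c < p.2}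

/-- The number of crossings among the arcs in `E`. -/
def crossingNum (E : Finset (ℕ × ℕ)) : ℕ :=
  #{q ∈ E ×ˢ E | q.1.1 < q.2.1 ∧ q.2.1 < q.1.2 ∧ q.1.2 < q.2.2}

theorem crossingNum_eq_sum (E : Finset (ℕ × ℕ)) :
    crossingNum E = ∑ p ∈ E, #{q ∈ E | q.1 < p.1 ∧ p.1 < q.2 ∧ q.2 < p.2} := by
  rw [crossingNum, card_filter, sum_product_right]
  simp only [card_filter]

/-- The factor `1 + q ^ m * x` of a block whose maximum lies under `m` arcs. -/
noncomputable def openFactor (m : ℕ) : ℝ[X][X] := 1 + C (X ^ m) * X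

/-- The generating function `q ^ cr * ∏ (1 + q ^ cover * x)` of the ways of opening some of the
blocks, whose maxima are `M`, of a partition with arc set `E`. -/
noncomputable def weight (E : Finset (ℕ × ℕ)) (M : Finset ℕ) : ℝ[X][X] :=
  C (X ^ crossingNum E) * ∏ c ∈ M, openFactor (coverNum E c)

variable {E : Finset (ℕ × ℕ)} {M : Finset ℕ} {n : ℕ}

theorem coverNum_of_forall_lt (hE : ∀ p ∈ E, p.2 < n) : coverNum E n = 0 := by
  rw [coverNum, card_eq_zero, filter_eq_empty_iff]
  intro p hp
  have := hE p hp
  omega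

theorem weight_insert_of_forall_lt (hE : ∀ p ∈ E, p.2 < n) (hM : ∀ c ∈ M, c < n) :
    weight E (insert n M) = (1 + X) * weight E M := by
  rw [weight, weight, prod_insert fun h => (hM n h).false, coverNum_of_forall_lt hE]
  simp [openFactor]
  ring

theorem coverNum_insert (hE : ∀ p ∈ E, p.2 < n) (c : ℕ) {d : ℕ} (hd : d < n) :
    coverNum (insert (c, n) E) d = coverNum E d + if c < d then 1 else 0 := by
  have hc : (c, n) ∉ E := fun h => (hE _ h).false
  rw [coverNum, coverNum, filter_insert]
  simp only [hd, and_true]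
  split_ifs
  · rw [card_insert_of_notMem (by simp [hc])]
  · rfl

theorem crossingNum_insert (hE : ∀ p ∈ E, p.2 < n) (c : ℕ) :
    crossingNum (insert (c, n) E) = crossingNum E + coverNum E c := by
  have hc : (c, n) ∉ E := fun h => (hE _ h).false
  rw [crossingNum_eq_sum, sum_insert hc, crossingNum_eq_sum, coverNum, add_comm]
  congr 1
  · refine sum_congr rfl fun p hp => ?_
    rw [filter_insert, if_neg]
    have := hE p hp
    simp only
    omega
  · rw [filter_insert, if_neg (by simp)]
    congr 1
    refine filter_congr fun p hp => ?_
    have := hE p hp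
    simp only
    omega

theorem prod_erase_eq_prod_lt_mul_prod_gt {c : ℕ} {R : Type*} [CommMonoid R] (f : ℕ → R) :
    ∏ d ∈ M.erase c, f d = (∏ d ∈ M with d < c, f d) * ∏ d ∈ M with c < d, f d := by
  rw [← prod_union (disjoint_filter.2 fun _ _ => by omega)]
  refine prod_congr ?_ fun _ _ => rfl
  ext d
  simp only [mem_erase, mem_union, mem_filter]
  grind

theorem weight_insert_arc (hE : ∀ p ∈ E, p.2 < n) (hM : ∀ c ∈ M, c < n) (c : ℕ) :
    weight (insert (c, n) E) (insert n (M.erase c)) =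
      (1 + X) * (C (X ^ crossingNum E) * (C (X ^ coverNum E c) *
        (∏ d ∈ M with d < c, openFactor (coverNum E d)) *
        ∏ d ∈ M with c < d, openFactor (coverNum E d + 1))) := by
  have hn : n ∉ M.erase c := fun h => (hM n (mem_of_mem_erase h)).false
  have h₀ : coverNum (insert (c, n) E) n = 0 :=
    card_eq_zero.2 <| filter_eq_empty_iff.2 fun p hp => by
      rcases mem_insert.1 hp with rfl | hp
      · simp
      · have := hE p hp
        omega
  have h₁ : ∏ d ∈ M with d < c, openFactor (coverNum (insert (c, n) E) d) =
      ∏ d ∈ M with d < c, openFactor (coverNum E d) :=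
    prod_congr rfl fun d hd => by
      rw [mem_filter] at hd
      rw [coverNum_insert hE c (hM d hd.1), if_neg (by omega), add_zero]
  have h₂ : ∏ d ∈ M with c < d, openFactor (coverNum (insert (c, n) E) d) =
      ∏ d ∈ M with c < d, openFactor (coverNum E d + 1) :=
    prod_congr rfl fun d hd => by
      rw [mem_filter] at hd
      rw [coverNum_insert hE c (hM d hd.1), if_pos hd.2]
  rw [weight, prod_insert hn, h₀, prod_erase_eq_prod_lt_mul_prod_gt, h₁, h₂,
    crossingNum_insert hE]
  rw [show openFactor 0 = 1 + X by simp [openFactor], pow_add, map_mul]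
  ring

/-- Joining a new point to one of the blocks acts on the weight as `1 + x` times the
`q`-derivative. -/
theorem exists_sum_weight_insert_arc (hE : ∀ p ∈ E, p.2 < n) (hM : ∀ c ∈ M, c < n) :
    ∃ Q : ℝ[X][X],
      ∑ c ∈ M, weight (insert (c, n) E) (insert n (M.erase c)) = (1 + X) * Q ∧
      ∀ h, Q.coeff h = (∑ i ∈ range (h + 1), X ^ i) * (weight E M).coeff (h + 1) := by
  refine ⟨_, (sum_congr rfl fun c _ => weight_insert_arc hE hM c).trans (mul_sum _ _ _).symm, ?_⟩
  set Q : ℝ[X][X] := ∑ c ∈ M, C (X ^ crossingNum E) * (C (X ^ coverNum E c) *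
        (∏ d ∈ M with d < c, openFactor (coverNum E d)) *
        ∏ d ∈ M with c < d, openFactor (coverNum E d + 1)) with hQ
  have key : X * (C (1 - X) * Q) = weight E M - (weight E M).comp (C X * X) := by
    have h := prod_add_ordered M (fun d => openFactor (coverNum E d + 1))
      (fun d => C ((1 - X) * X ^ coverNum E d) * X)
    have h' (d : ℕ) : openFactor (coverNum E d + 1) +
        C ((1 - X) * X ^ coverNum E d) * X = openFactor (coverNum E d) := by
      simp only [openFactor, map_mul, map_sub, map_one, pow_succ]
      ring
    simp only [h'] at h
    have h'' : (weight E M).comp (C X * X) = C (X ^ crossingNum E) *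
        ∏ d ∈ M, openFactor (coverNum E d + 1) := by
      rw [weight, mul_comp, Polynomial.prod_comp]
      simp [openFactor, pow_succ, mul_assoc]
    rw [h'', weight, h, hQ, mul_sum, mul_sum, mul_add, add_sub_cancel_left, mul_sum]
    refine sum_congr rfl fun c _ => ?_
    simp only [map_mul]
    ring
  intro h
  have h₁ : (1 - X : ℝ[X]) ≠ 0 := fun h => by simpa using congrArg (eval 0) h
  apply mul_left_cancel₀ h₁
  have h₂ := congrArg (fun p => coeff p (h + 1)) key
  simp only [coeff_X_mul, coeff_C_mul, coeff_sub, comp_C_mul_X_coeff] at h₂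
  rw [h₂, ← mul_assoc, mul_neg_geom_sum]
  ring

end Weight

section Partition

variable {n : ℕ}

theorem sameBlock_iff_part_eq (π : Finpartition (univ : Finset (Fin n))) (a b : Fin n) :
    sameBlock π a b ↔ π.part a = π.part b := by
  constructor
  · rintro ⟨B, hB, ha, hb⟩
    rw [π.part_eq_of_mem hB ha, π.part_eq_of_mem hB hb]
  · intro h
    exact ⟨π.part a, π.part_mem.2 (mem_univ a), π.mem_part (mem_univ a),
      h ▸ π.mem_part (mem_univ b)⟩

theorem Finpartition.ext_sameBlock {π σ : Finpartition (univ : Finset (Fin n))}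
    (h : ∀ a b, sameBlock π a b ↔ sameBlock σ a b) : π = σ := by
  have key (π σ : Finpartition (univ : Finset (Fin n)))
      (h : ∀ a b, sameBlock π a b ↔ sameBlock σ a b) : π.parts ⊆ σ.parts := by
    intro B hB
    obtain ⟨a, ha⟩ := π.nonempty_of_mem_parts hB
    have : B = σ.part a := by
      ext b
      rw [← π.part_eq_of_mem hB ha]
      have h₁ := h a b
      rw [sameBlock_iff_part_eq, sameBlock_iff_part_eq] at h₁
      rw [π.mem_part_iff_part_eq_part (mem_univ _) (mem_univ _),
        σ.mem_part_iff_part_eq_part (mem_univ _) (mem_univ _)]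
      grind
    rw [this]
    exact σ.part_mem.2 (mem_univ a)
  exact Finpartition.ext ((key π σ h).antisymm (key σ π fun a b => (h a b).symm))

open Classical in
theorem sameBlock_ofSetoid (r : Setoid (Fin n)) (a b : Fin n) :
    sameBlock (Finpartition.ofSetoid r) a b ↔ r a b := by
  rw [sameBlock_iff_part_eq, ← Finpartition.mem_part_iff_part_eq_part _ (mem_univ _) (mem_univ _),
    Finpartition.mem_part_ofSetoid_iff_rel, Setoid.comm']

/-- The equivalence relation on `ℕ` whose classes are the blocks of `π` and singletons. -/
def natSetoid (π : Finpartition (univ : Finset (Fin n))) : Setoid ℕ where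
  r a b := a = b ∨ ∃ (ha : a < n) (hb : b < n), sameBlock π ⟨a, ha⟩ ⟨b, hb⟩
  iseqv :=
    { refl _ := .inl rfl
      symm := by
        simp only [sameBlock_iff_part_eq]
        grind
      trans := by
        simp only [sameBlock_iff_part_eq]
        grind }

theorem natSetoid_val (π : Finpartition (univ : Finset (Fin n))) (a b : Fin n) :
    natSetoid π a b ↔ sameBlock π a b := by
  change ((a : ℕ) = b ∨ ∃ (_ : (a : ℕ) < n) (_ : (b : ℕ) < n), sameBlock π a b) ↔ _
  simp only [sameBlock_iff_part_eq]
  grind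

theorem eq_or_lt_of_natSetoid {π : Finpartition (univ : Finset (Fin n))} {a b : ℕ}
    (h : natSetoid π a b) : a = b ∨ a < n ∧ b < n := by
  rcases h with h | ⟨ha, hb, -⟩
  exacts [.inl h, .inr ⟨ha, hb⟩]

open Classical in
/-- The arcs of `π`, as pairs of natural numbers. -/
noncomputable def arcSet (π : Finpartition (univ : Finset (Fin n))) : Finset (ℕ × ℕ) :=
  {p ∈ range n ×ˢ range n | p.1 < p.2 ∧ natSetoid π p.1 p.2 ∧
    ∀ d, p.1 < d → d < p.2 → ¬ natSetoid π p.1 d}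

open Classical in
/-- The maxima of the blocks of `π`. -/
noncomputable def maxSet (π : Finpartition (univ : Finset (Fin n))) : Finset ℕ :=
  {c ∈ range n | ∀ d, natSetoid π c d → d ≤ c}

theorem mem_arcSet {π : Finpartition (univ : Finset (Fin n))} {a b : ℕ} :
    (a, b) ∈ arcSet π ↔ a < b ∧ b < n ∧ natSetoid π a b ∧
      ∀ d, a < d → d < b → ¬ natSetoid π a d := by
  simp only [arcSet, mem_filter, mem_product, mem_range]
  grind

theorem mem_maxSet {π : Finpartition (univ : Finset (Fin n))} {c : ℕ} :
    c ∈ maxSet π ↔ c < n ∧ ∀ d, natSetoid π c d → d ≤ c := by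
  simp [maxSet]

theorem snd_lt_of_mem_arcSet {π : Finpartition (univ : Finset (Fin n))} :
    ∀ p ∈ arcSet π, p.2 < n := fun _ hp => (mem_arcSet.1 hp).2.1

theorem lt_of_mem_maxSet {π : Finpartition (univ : Finset (Fin n))} :
    ∀ c ∈ maxSet π, c < n := fun _ hc => (mem_maxSet.1 hc).1

theorem crl_eq_crossingNum (π : Finpartition (univ : Finset (Fin n))) :
    crl π = crossingNum (arcSet π) := by
  have harc (a b : Fin n) : IsArc π a b ↔ ((a : ℕ), (b : ℕ)) ∈ arcSet π := by
    rw [IsArc, mem_arcSet, ← natSetoid_val, Fin.lt_def]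
    have h : (∀ c : Fin n, a < c → c < b → ¬ sameBlock π a c) ↔
        ∀ d : ℕ, (a : ℕ) < d → d < b → ¬ natSetoid π a d := by
      simp only [← natSetoid_val]
      exact ⟨fun h d h₁ h₂ => h ⟨d, h₂.trans b.2⟩ h₁ h₂, fun h c h₁ h₂ => h c h₁ h₂⟩
    rw [h]
    simp
  rw [crl, crossingNum, ← Set.ncard_coe_finset]
  refine Set.ncard_congr (fun q _ => (((q.1.1 : ℕ), (q.1.2 : ℕ)), ((q.2.1 : ℕ), (q.2.2 : ℕ))))
    ?_ ?_ ?_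
  · rintro ⟨⟨a, b⟩, ⟨c, d⟩⟩ h
    simp only [Set.mem_ofPred_eq, harc, Fin.lt_def] at h
    simpa [and_assoc] using h
  · rintro ⟨⟨a, b⟩, ⟨c, d⟩⟩ ⟨⟨a', b'⟩, ⟨c', d'⟩⟩ _ _ h
    simpa [Fin.ext_iff] using h
  · rintro ⟨⟨a, b⟩, ⟨c, d⟩⟩ h
    simp only [coe_filter, mem_product, Set.mem_ofPred_eq] at h
    obtain ⟨⟨h₁, h₂⟩, h₃⟩ := h
    have hb := (mem_arcSet.1 h₁).2.1
    have hd := (mem_arcSet.1 h₂).2.1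
    exact ⟨((⟨a, by omega⟩, ⟨b, hb⟩), (⟨c, by omega⟩, ⟨d, hd⟩)),
      ⟨(harc _ _).2 h₁, (harc _ _).2 h₂, h₃⟩, rfl⟩

theorem card_parts_eq_card_maxSet (π : Finpartition (univ : Finset (Fin n))) :
    #π.parts = #(maxSet π) := by
  symm
  refine card_bij (fun c hc => π.part ⟨c, lt_of_mem_maxSet c hc⟩) ?_ ?_ ?_
  · intro c hc
    exact π.part_mem.2 (mem_univ _)
  · intro c hc d hd h
    rw [← sameBlock_iff_part_eq] at h
    have h : natSetoid π c d := .inr ⟨_, _, h⟩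
    exact ((mem_maxSet.1 hd).2 c ((natSetoid π).symm' h)).antisymm ((mem_maxSet.1 hc).2 d h)
  · intro B hB
    obtain ⟨c, hc, hmax⟩ := exists_max_image B id (π.nonempty_of_mem_parts hB)
    refine ⟨c, mem_maxSet.2 ⟨c.2, fun d hd => ?_⟩, π.part_eq_of_mem hB hc⟩
    rcases eq_or_lt_of_natSetoid hd with h | ⟨-, h⟩
    · exact h.ge
    · have h' := (natSetoid_val π c ⟨d, h⟩).1 hd
      rw [sameBlock_iff_part_eq, π.part_eq_of_mem hB hc] at h'
      exact hmax ⟨d, h⟩ (h' ▸ π.mem_part (mem_univ _))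

open Classical in
/-- Insert a new largest point in the block of `c`, or as a singleton if `c = n`. -/
noncomputable def insertPoint (π : Finpartition (univ : Finset (Fin n))) (c : ℕ) :
    Finpartition (univ : Finset (Fin (n + 1))) :=
  Finpartition.ofSetoid ((natSetoid π).comap fun i : Fin (n + 1) => if (i : ℕ) < n then (i : ℕ) else c)

open Classical in
/-- Delete the largest point. -/
noncomputable def deletePoint (π : Finpartition (univ : Finset (Fin (n + 1)))) :
    Finpartition (univ : Finset (Fin n)) :=
  Finpartition.ofSetoid ((natSetoid π).comap fun i : Fin n => (i : ℕ))

theorem natSetoid_deletePoint (π : Finpartition (univ : Finset (Fin (n + 1)))) {a b : ℕ}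
    (ha : a < n) (hb : b < n) : natSetoid (deletePoint π) a b ↔ natSetoid π a b := by
  rw [natSetoid_val (deletePoint π) ⟨a, ha⟩ ⟨b, hb⟩, deletePoint, sameBlock_ofSetoid]
  rfl

theorem natSetoid_insertPoint (π : Finpartition (univ : Finset (Fin n))) (c : ℕ) {a b : ℕ}
    (ha : a ≤ n) (hb : b ≤ n) : natSetoid (insertPoint π c) a b ↔
      natSetoid π (if a < n then a else c) (if b < n then b else c) := by
  rw [natSetoid_val (insertPoint π c) ⟨a, by omega⟩ ⟨b, by omega⟩, insertPoint,
    sameBlock_ofSetoid]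
  rfl

theorem natSetoid_ext {π σ : Finpartition (univ : Finset (Fin n))}
    (h : ∀ a b, a < n → b < n → (natSetoid π a b ↔ natSetoid σ a b)) : π = σ :=
  Finpartition.ext_sameBlock fun a b => by
    rw [← natSetoid_val, ← natSetoid_val, h a b a.2 b.2]

theorem deletePoint_insertPoint (π : Finpartition (univ : Finset (Fin n))) (c : ℕ) :
    deletePoint (insertPoint π c) = π :=
  natSetoid_ext fun a b ha hb => by
    rw [natSetoid_deletePoint _ ha hb, natSetoid_insertPoint _ _ ha.le hb.le, if_pos ha, if_pos hb]

theorem insertPoint_left_inj (π : Finpartition (univ : Finset (Fin n))) {c d : ℕ}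
    (hc : c ∈ insert n (maxSet π)) (hd : d ∈ insert n (maxSet π))
    (h : insertPoint π c = insertPoint π d) : c = d := by
  have key {c d : ℕ} (hc : c ∈ maxSet π) (h : insertPoint π c = insertPoint π d) :
      natSetoid π c d := by
    have hcn := lt_of_mem_maxSet c hc
    have h₁ : natSetoid (insertPoint π c) c n := by
      rw [natSetoid_insertPoint _ _ hcn.le le_rfl, if_pos hcn, if_neg (lt_irrefl n)]
    rwa [h, natSetoid_insertPoint _ _ hcn.le le_rfl, if_pos hcn, if_neg (lt_irrefl n)] at h₁
  rcases mem_insert.1 hc with rfl | hc <;> rcases mem_insert.1 hd with rfl | hd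
  · rfl
  · have h₁ := key hd h.symm
    exact (by simpa using eq_or_lt_of_natSetoid h₁ : d = c).symm
  · have h₁ := key hc h
    exact by simpa using eq_or_lt_of_natSetoid h₁
  · have h₁ := key hc h
    exact ((mem_maxSet.1 hd).2 c ((natSetoid π).symm' h₁)).antisymm ((mem_maxSet.1 hc).2 d h₁)

theorem exists_insertPoint_deletePoint (π : Finpartition (univ : Finset (Fin (n + 1)))) :
    ∃ c ∈ insert n (maxSet (deletePoint π)), insertPoint (deletePoint π) c = π := by
  classical
  have build (c : ℕ) (hc : ∀ a < n, natSetoid (deletePoint π) a c ↔ natSetoid π a n) :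
      insertPoint (deletePoint π) c = π := by
    refine natSetoid_ext fun a b ha hb => ?_
    rw [natSetoid_insertPoint _ _ (by omega) (by omega)]
    split_ifs with h₁ h₂ h₂
    · exact natSetoid_deletePoint π h₁ h₂
    · rw [hc a h₁, show b = n by omega]
    · rw [Setoid.comm', hc b h₂, Setoid.comm', show a = n by omega]
    · rw [show a = n by omega, show b = n by omega]
      exact iff_of_true ((natSetoid _).refl' _) ((natSetoid _).refl' _)
  by_cases hne : ({c ∈ range n | natSetoid π c n} : Finset ℕ).Nonempty
  · obtain ⟨c, hc, hmax⟩ := exists_max_image _ id hne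
    simp only [mem_filter, mem_range, id] at hc hmax
    refine ⟨c, mem_insert_of_mem (mem_maxSet.2 ⟨hc.1, fun d hd => ?_⟩), build c fun a ha => ?_⟩
    · rcases eq_or_lt_of_natSetoid hd with h | ⟨-, h⟩
      · exact h.ge
      · rw [natSetoid_deletePoint _ hc.1 h] at hd
        exact hmax d ⟨h, (natSetoid π).trans' ((natSetoid π).symm' hd) hc.2⟩
    · rw [natSetoid_deletePoint _ ha hc.1]
      exact ⟨fun h => (natSetoid π).trans' h hc.2,
        fun h => (natSetoid π).trans' h ((natSetoid π).symm' hc.2)⟩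
  · refine ⟨n, mem_insert_self _ _, build n fun a ha => iff_of_false (fun h => ?_) fun h => ?_⟩
    · have := eq_or_lt_of_natSetoid h
      omega
    · exact hne ⟨a, by simp [ha, h]⟩

theorem sum_insertPoint {R : Type*} [AddCommMonoid R]
    (f : Finpartition (univ : Finset (Fin (n + 1))) → R) :
    ∑ π, f π = ∑ π : Finpartition (univ : Finset (Fin n)),
      (f (insertPoint π n) + ∑ c ∈ maxSet π, f (insertPoint π c)) := by
  have h (π : Finpartition (univ : Finset (Fin n))) :
      f (insertPoint π n) + ∑ c ∈ maxSet π, f (insertPoint π c) =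
        ∑ c ∈ insert n (maxSet π), f (insertPoint π c) := by
    rw [sum_insert fun h => (lt_of_mem_maxSet n h).false]
  simp only [h]
  rw [sum_sigma']
  symm
  refine sum_bij (fun x _ => insertPoint x.1 x.2) (fun _ _ => mem_univ _) ?_ ?_ fun _ _ => rfl
  · rintro ⟨π, c⟩ hc ⟨σ, d⟩ hd heq
    simp only [mem_sigma, mem_univ, true_and] at hc hd heq
    obtain rfl : π = σ := by
      rw [← deletePoint_insertPoint π c, heq, deletePoint_insertPoint]
    rw [insertPoint_left_inj π hc hd heq]
  · intro π _
    obtain ⟨c, hc, h⟩ := exists_insertPoint_deletePoint π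
    exact ⟨⟨deletePoint π, c⟩, by simpa using hc, h⟩

theorem natSetoid_insertPoint_of_lt (π : Finpartition (univ : Finset (Fin n))) (c : ℕ) {a b : ℕ}
    (ha : a < n) (hb : b < n) : natSetoid (insertPoint π c) a b ↔ natSetoid π a b := by
  rw [natSetoid_insertPoint _ _ ha.le hb.le, if_pos ha, if_pos hb]

theorem natSetoid_insertPoint_last (π : Finpartition (univ : Finset (Fin n))) (c : ℕ) {a : ℕ}
    (ha : a < n) : natSetoid (insertPoint π c) a n ↔ natSetoid π a c := by
  rw [natSetoid_insertPoint _ _ ha.le le_rfl, if_pos ha, if_neg (lt_irrefl n)]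

theorem natSetoid_iff_eq_of_mem_maxSet {π : Finpartition (univ : Finset (Fin n))} {c d : ℕ}
    (hc : c ∈ insert n (maxSet π)) (hd : d ∈ maxSet π) : natSetoid π d c ↔ d = c := by
  refine ⟨fun h => ?_, fun h => h ▸ (natSetoid π).refl' _⟩
  rcases mem_insert.1 hc with rfl | hc
  · simpa using eq_or_lt_of_natSetoid h
  · exact ((mem_maxSet.1 hc).2 d ((natSetoid π).symm' h)).antisymm ((mem_maxSet.1 hd).2 c h)

theorem maxSet_insertPoint (π : Finpartition (univ : Finset (Fin n))) {c : ℕ}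
    (hc : c ∈ insert n (maxSet π)) :
    maxSet (insertPoint π c) = insert n ((maxSet π).erase c) := by
  ext d
  rw [mem_insert, mem_erase, mem_maxSet]
  constructor
  · rintro ⟨hd, h⟩
    rcases Nat.lt_succ_iff_lt_or_eq.1 hd with hd | rfl
    · have hmax : d ∈ maxSet π := mem_maxSet.2 ⟨hd, fun e he => by
        rcases eq_or_lt_of_natSetoid he with h' | ⟨-, h'⟩
        · exact h'.ge
        · exact h e ((natSetoid_insertPoint_of_lt π c hd h').2 he)⟩
      refine .inr ⟨fun heq => ?_, hmax⟩
      have := h n ((natSetoid_insertPoint_last π c hd).2 (heq ▸ (natSetoid π).refl' _))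
      omega
    · exact .inl rfl
  · rintro (rfl | ⟨hdc, hd⟩)
    · refine ⟨d.lt_succ_self, fun e he => ?_⟩
      rcases eq_or_lt_of_natSetoid he with h' | ⟨-, h'⟩ <;> omega
    · have hdn := lt_of_mem_maxSet d hd
      refine ⟨by omega, fun e he => ?_⟩
      rcases eq_or_lt_of_natSetoid he with h' | ⟨-, h'⟩
      · exact h'.ge
      · rcases Nat.lt_succ_iff_lt_or_eq.1 h' with h' | rfl
        · exact (mem_maxSet.1 hd).2 e ((natSetoid_insertPoint_of_lt π c hdn h').1 he)
        · exact absurd ((natSetoid_iff_eq_of_mem_maxSet hc hd).1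
            ((natSetoid_insertPoint_last π c hdn).1 he)) hdc

theorem mem_arcSet_insertPoint_of_lt (π : Finpartition (univ : Finset (Fin n))) (c : ℕ) {a b : ℕ}
    (hb : b < n) : (a, b) ∈ arcSet (insertPoint π c) ↔ (a, b) ∈ arcSet π := by
  simp only [mem_arcSet]
  constructor
  · rintro ⟨hab, -, h, h'⟩
    exact ⟨hab, hb, (natSetoid_insertPoint_of_lt π c (hab.trans hb) hb).1 h, fun d h₁ h₂ h₃ =>
      h' d h₁ h₂ ((natSetoid_insertPoint_of_lt π c (hab.trans hb) (h₂.trans hb)).2 h₃)⟩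
  · rintro ⟨hab, -, h, h'⟩
    exact ⟨hab, by omega, (natSetoid_insertPoint_of_lt π c (hab.trans hb) hb).2 h,
      fun d h₁ h₂ h₃ =>
        h' d h₁ h₂ ((natSetoid_insertPoint_of_lt π c (hab.trans hb) (h₂.trans hb)).1 h₃)⟩

theorem mem_arcSet_insertPoint_last (π : Finpartition (univ : Finset (Fin n))) {c : ℕ}
    (hc : c ∈ insert n (maxSet π)) {a : ℕ} :
    (a, n) ∈ arcSet (insertPoint π c) ↔ a < n ∧ a = c := by
  rw [mem_arcSet]
  constructor
  · rintro ⟨ha, -, h, h'⟩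
    have hmax : a ∈ maxSet π := mem_maxSet.2 ⟨ha, fun d hd => by
      rcases eq_or_lt_of_natSetoid hd with h₁ | ⟨-, h₁⟩
      · exact h₁.ge
      · by_contra! h₂
        exact h' d h₂ h₁ ((natSetoid_insertPoint_of_lt π c ha h₁).2 hd)⟩
    exact ⟨ha, (natSetoid_iff_eq_of_mem_maxSet hc hmax).1
      ((natSetoid_insertPoint_last π c ha).1 h)⟩
  · rintro ⟨ha, rfl⟩
    have hmax : a ∈ maxSet π := (mem_insert.1 hc).resolve_left ha.ne
    refine ⟨ha, n.lt_succ_self, (natSetoid_insertPoint_last π a ha).2 ((natSetoid π).refl' _),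
      fun d h₁ h₂ h₃ => ?_⟩
    exact h₁.not_ge ((mem_maxSet.1 hmax).2 d ((natSetoid_insertPoint_of_lt π a ha h₂).1 h₃))

theorem arcSet_insertPoint_self (π : Finpartition (univ : Finset (Fin n))) :
    arcSet (insertPoint π n) = arcSet π := by
  ext ⟨a, b⟩
  rcases lt_trichotomy b n with hb | rfl | hb
  · exact mem_arcSet_insertPoint_of_lt π n hb
  · rw [mem_arcSet_insertPoint_last π (mem_insert_self _ _)]
    exact iff_of_false (fun h => h.1.ne h.2) fun h => (snd_lt_of_mem_arcSet _ h).false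
  · simp only [mem_arcSet]
    exact iff_of_false (by omega) (by omega)

theorem arcSet_insertPoint (π : Finpartition (univ : Finset (Fin n))) {c : ℕ}
    (hc : c ∈ maxSet π) :
    arcSet (insertPoint π c) = insert (c, n) (arcSet π) := by
  have hcn := lt_of_mem_maxSet c hc
  ext ⟨a, b⟩
  rw [mem_insert, Prod.mk.injEq]
  rcases lt_trichotomy b n with hb | rfl | hb
  · rw [mem_arcSet_insertPoint_of_lt π c hb]
    simp [hb.ne]
  · rw [mem_arcSet_insertPoint_last π (mem_insert_of_mem hc)]
    have h : (a, b) ∉ arcSet π := fun h => (snd_lt_of_mem_arcSet _ h).false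
    grind
  · simp only [mem_arcSet]
    omega

end Partition

section OpenCrossingPoly

open Polynomial

/-- The generating polynomial in `q` of crossing numbers of partitions of `[n]` with `k` blocks,
`h` of which are marked as open. -/
noncomputable def openCrossingPoly (n : ℕ) (k : ℝ) (h : ℕ) : ℝ[X] :=
  ∑ π : Finpartition (univ : Finset (Fin n)),
    if (#(maxSet π) : ℝ) = k then (weight (arcSet π) (maxSet π)).coeff h else 0

variable {n : ℕ}

theorem exists_sum_weight_insertPoint (π : Finpartition (univ : Finset (Fin n))) :
    ∃ Q : ℝ[X][X],
      ∑ c ∈ maxSet π, weight (arcSet (insertPoint π c)) (maxSet (insertPoint π c)) =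
        (1 + X) * Q ∧
      ∀ h, Q.coeff h =
        (∑ i ∈ range (h + 1), X ^ i) * (weight (arcSet π) (maxSet π)).coeff (h + 1) := by
  obtain ⟨Q, hQ, h⟩ := exists_sum_weight_insert_arc (snd_lt_of_mem_arcSet (π := π))
    (lt_of_mem_maxSet (π := π))
  refine ⟨Q, hQ ▸ sum_congr rfl fun c hc => ?_, h⟩
  rw [arcSet_insertPoint π hc, maxSet_insertPoint π (mem_insert_of_mem hc)]

theorem card_maxSet_insertPoint_self (π : Finpartition (univ : Finset (Fin n))) :
    #(maxSet (insertPoint π n)) = #(maxSet π) + 1 := by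
  have hn : n ∉ maxSet π := fun h => (lt_of_mem_maxSet n h).false
  rw [maxSet_insertPoint π (mem_insert_self _ _), erase_eq_of_notMem hn,
    card_insert_of_notMem hn]

theorem card_maxSet_insertPoint (π : Finpartition (univ : Finset (Fin n))) {c : ℕ}
    (hc : c ∈ maxSet π) : #(maxSet (insertPoint π c)) = #(maxSet π) := by
  have hn : n ∉ (maxSet π).erase c := fun h => (lt_of_mem_maxSet n (mem_of_mem_erase h)).false
  rw [maxSet_insertPoint π (mem_insert_of_mem hc), card_insert_of_notMem hn,
    card_erase_add_one hc]

theorem weight_insertPoint_self (π : Finpartition (univ : Finset (Fin n))) :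
    weight (arcSet (insertPoint π n)) (maxSet (insertPoint π n)) =
      (1 + X) * weight (arcSet π) (maxSet π) := by
  rw [arcSet_insertPoint_self, maxSet_insertPoint π (mem_insert_self _ _),
    erase_eq_of_notMem fun h => (lt_of_mem_maxSet n h).false,
    weight_insert_of_forall_lt snd_lt_of_mem_arcSet lt_of_mem_maxSet]

theorem openCrossingPoly_succ (n : ℕ) (k : ℝ) (h : ℕ) :
    openCrossingPoly (n + 1) k h = ∑ π : Finpartition (univ : Finset (Fin n)),
      ((if (#(maxSet π) : ℝ) = k - 1 then
        ((1 + X) * weight (arcSet π) (maxSet π)).coeff h else 0) +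
      if (#(maxSet π) : ℝ) = k then
        (∑ c ∈ maxSet π,
          weight (arcSet (insertPoint π c)) (maxSet (insertPoint π c))).coeff h else 0) := by
  rw [openCrossingPoly, sum_insertPoint]
  refine sum_congr rfl fun π _ => ?_
  rw [card_maxSet_insertPoint_self, weight_insertPoint_self, Nat.cast_succ]
  congr 1
  · simp only [eq_sub_iff_add_eq]
  · rw [sum_congr rfl fun c hc => by rw [card_maxSet_insertPoint π hc]]
    split_ifs
    · rw [finsetSum_coeff]
    · rw [sum_const_zero]

theorem isOpenCrossingPoly_openCrossingPoly : IsOpenCrossingPoly openCrossingPoly where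
  zero k h := by
    have h₁ (π : Finpartition (univ : Finset (Fin 0))) : maxSet π = ∅ :=
      eq_empty_of_forall_notMem fun c hc => by simpa using lt_of_mem_maxSet c hc
    have h₂ (π : Finpartition (univ : Finset (Fin 0))) : arcSet π = ∅ :=
      eq_empty_of_forall_notMem fun p hp => by simpa using snd_lt_of_mem_arcSet p hp
    have h₃ : weight ∅ ∅ = 1 := by simp [weight, crossingNum]
    have : Unique (Finpartition (univ : Finset (Fin 0))) :=
      inferInstanceAs (Unique (Finpartition (⊥ : Finset (Fin 0))))
    rw [openCrossingPoly, Fintype.sum_unique, h₁, h₂, h₃, coeff_one]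
    simp only [card_empty, Nat.cast_zero, eq_comm (a := (0 : ℝ))]
    split_ifs <;> simp_all
  succ_zero n k := by
    rw [openCrossingPoly_succ, openCrossingPoly, openCrossingPoly, mul_sum, ← sum_add_distrib]
    refine sum_congr rfl fun π _ => ?_
    obtain ⟨Q, hQ, hc⟩ := exists_sum_weight_insertPoint π
    rw [hQ, mul_ite, mul_zero, ← hc]
    simp [mul_coeff_zero]
  succ_succ n k h := by
    rw [openCrossingPoly_succ]
    simp only [openCrossingPoly, mul_sum, ← sum_add_distrib]
    refine sum_congr rfl fun π _ => ?_
    obtain ⟨Q, hQ, hc⟩ := exists_sum_weight_insertPoint π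
    rw [hQ, mul_ite, mul_ite, mul_zero, mul_zero, ← hc, ← hc]
    simp only [add_mul, one_mul, coeff_add, coeff_X_mul]
    split_ifs <;> ring

theorem weight_coeff_zero (E : Finset (ℕ × ℕ)) (M : Finset ℕ) :
    (weight E M).coeff 0 = X ^ crossingNum E := by
  rw [weight, mul_coeff_zero, coeff_C_zero, coeff_zero_prod]
  simp [openFactor]

theorem openCrossingPoly_zero (n k : ℕ) :
    openCrossingPoly n k 0 = ∑ π ∈ Pik n k, X ^ crl π := by
  rw [openCrossingPoly, Pik, sum_filter]
  simp only [weight_coeff_zero, Nat.cast_inj, card_parts_eq_card_maxSet, crl_eq_crossingNum]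

theorem stirling_eq_realStirling (n k : ℕ) : (stirling n k : ℝ) = realStirling n k := by
  have h := isOpenCrossingPoly_openCrossingPoly.eval_one n k 0
  rw [openCrossingPoly_zero, realChoose, mul_one] at h
  rw [← h, stirling, Nat.card_eq_fintype_card, Fintype.card_subtype]
  simp [eval_finsetSum, Pik]

theorem realStirling_neg_one (n : ℕ) : realStirling n (-1) = 0 := by
  have h := isOpenCrossingPoly_openCrossingPoly.eval_one n (-1) 0
  rw [realChoose, mul_one] at h
  rw [← h, openCrossingPoly, sum_eq_zero, eval_zero]
  intro π _
  rw [if_neg]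
  have : (0 : ℝ) ≤ #(maxSet π) := by positivity
  linarith

theorem sum_crl_mul_crl_sub_one (n k : ℕ) :
    ∑ π ∈ Pik n k, (crl π : ℝ) * ((crl π : ℝ) - 1) =
      secondTop n k + secondMid n k + secondBot n k := by
  have h := isOpenCrossingPoly_openCrossingPoly.eval_one_derivative_two n k 0
  simp only [realChoose, mul_one] at h
  rw [← h, openCrossingPoly_zero, derivative_sum, derivative_sum, eval_finsetSum]
  refine sum_congr rfl fun π _ => ?_
  rcases crl π with _ | m <;> simp [derivative_X_pow]

end OpenCrossingPoly

/-- Exact formula for the second factorial moment sum of the linear crossing number on `Π_n^k`. -/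
theorem factorial_moment2_crl (n k : ℕ) (hk : 1 ≤ k) (hkn : k ≤ n) :
    (∑ π ∈ Pik n k, (crl π : ℝ) * ((crl π : ℝ) - 1)) =
      ((k : ℝ) - 1) ^ 2 / 4 * (n : ℝ) ^ 2 * (stirling n k : ℝ)
        - ((k : ℝ) - 1) / 12 * (15 * (k : ℝ) ^ 2 - 16 * (k : ℝ) + 5) * (n : ℝ) *
          (stirling n k : ℝ)
        + (k : ℝ) * ((k : ℝ) - 1) / 144 * (225 * (k : ℝ) ^ 2 - 229 * (k : ℝ) + 170) *
          (stirling n k : ℝ)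
        + (1 / 12 : ℝ) * ((18 * (k : ℝ) - 33) * (n : ℝ) ^ 2
            - (63 * (k : ℝ) ^ 2 - 137 * (k : ℝ) + 79) * (n : ℝ)
            + ((k : ℝ) - 1) * (45 * (k : ℝ) ^ 2 - 73 * (k : ℝ) + 20)) *
          (stirling n (k - 1) : ℝ)
        + (1 / 12 : ℝ) * (27 * (n : ℝ) ^ 2 - (54 * (k : ℝ) - 55) * (n : ℝ)
            + ((k : ℝ) - 2) * (27 * (k : ℝ) - 1)) *
          (stirling n (k - 2) : ℝ) := by
  have h₁ : (stirling n (k - 1) : ℝ) = realStirling n ((k : ℝ) - 1) := by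
    rw [stirling_eq_realStirling, Nat.cast_pred hk]
  have h₂ : (stirling n (k - 2) : ℝ) = realStirling n ((k : ℝ) - 2) := by
    rw [stirling_eq_realStirling]
    rcases hk.eq_or_lt with rfl | hk
    · obtain ⟨m, rfl⟩ := Nat.exists_eq_add_of_le' hkn
      rw [show ((1 : ℕ) : ℝ) - 2 = -1 by norm_num, realStirling_neg_one]
      simp [realStirling, realStirling_neg_one]
    · rw [Nat.cast_sub hk, Nat.cast_two]
  rw [sum_crl_mul_crl_sub_one, h₁, h₂, stirling_eq_realStirling, secondTop, secondMid, secondBot]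
  ring
end

section
/- For every set partition π of [n] with exactly k blocks, cr^ℓ(π) ≤ cr^c(π) ≤ cr^ℓ(π) + 2·k·(k−1). -/
open Finset

/-- Two elements share a block exactly when their blocks `π.part` agree. -/
lemma sameBlock_iff {n : ℕ} {π : Finpartition (univ : Finset (Fin n))} {a b : Fin n} :
    sameBlock π a b ↔ π.part a = π.part b := by
  constructor
  · rintro ⟨B, hB, ha, hb⟩
    rw [π.part_eq_of_mem hB ha, π.part_eq_of_mem hB hb]
  · intro h
    exact ⟨π.part a, π.part_mem.2 (mem_univ a), π.mem_part_self.2 (mem_univ a),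
      h ▸ π.mem_part_self.2 (mem_univ b)⟩

/-- `a < b` are the minimum and the maximum of a block of `π`. -/
def IsSpan {n : ℕ} (π : Finpartition (univ : Finset (Fin n))) (a b : Fin n) : Prop :=
  a < b ∧ π.part a = π.part b ∧ ∀ c, π.part c = π.part a → a ≤ c ∧ c ≤ b

lemma isArc_iff {n : ℕ} {π : Finpartition (univ : Finset (Fin n))} {a b : Fin n} :
    IsArc π a b ↔ a < b ∧ π.part a = π.part b ∧
      ∀ c, π.part c = π.part a → ¬(a < c ∧ c < b) := by
  simp only [IsArc, sameBlock_iff]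
  grind

lemma IsArc.isChord {n : ℕ} {π : Finpartition (univ : Finset (Fin n))} {a b : Fin n}
    (h : IsArc π a b) : IsChord π a b := by
  obtain ⟨hab, ⟨B, hB, ha, hb⟩, hc⟩ := h
  exact ⟨hab, B, hB, ha, hb, .inl fun c hcB hlt => hc c hlt.1 hlt.2 ⟨B, hB, ha, hcB⟩⟩

lemma IsChord.isArc_or_isSpan {n : ℕ} {π : Finpartition (univ : Finset (Fin n))} {a b : Fin n}
    (h : IsChord π a b) : IsArc π a b ∨ IsSpan π a b := by
  obtain ⟨hab, B, hB, ha, hb, hc⟩ := h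
  have hpa := π.part_eq_of_mem hB ha
  have hpb := π.part_eq_of_mem hB hb
  have hmem : ∀ c, π.part c = π.part a → c ∈ B := fun c hc =>
    (π.part_eq_iff_mem hB).1 (hc.trans hpa)
  rcases hc with hc | ⟨-, hc⟩
  · exact .inl (isArc_iff.2 ⟨hab, hpa.trans hpb.symm, fun c h => hc c (hmem c h)⟩)
  · exact .inr ⟨hab, hpa.trans hpb.symm, fun c h => hc c (hmem c h)⟩

/-- The pairs `(a, b)` and `(c, d)` satisfy `a < c < b < d`. -/
def Interlace {n : ℕ} (q : (Fin n × Fin n) × (Fin n × Fin n)) : Prop :=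
  q.1.1 < q.2.1 ∧ q.2.1 < q.1.2 ∧ q.1.2 < q.2.2

lemma IsSpan.unique {n : ℕ} {π : Finpartition (univ : Finset (Fin n))} {a b c d : Fin n}
    (h : IsSpan π a b) (h' : IsSpan π c d) (hac : π.part a = π.part c) : a = c ∧ b = d := by
  obtain ⟨-, hb, h⟩ := h
  obtain ⟨-, hd, h'⟩ := h'
  exact ⟨le_antisymm (h c hac.symm).1 (h' a hac).1,
    le_antisymm (h' b (hb.symm.trans hac)).2 (h d (hd.symm.trans hac.symm)).2⟩

/-- At most one arc of a given block passes over a given element. -/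
lemma IsArc.unique {n : ℕ} {π : Finpartition (univ : Finset (Fin n))} {a b c d x : Fin n}
    (h : IsArc π a b) (h' : IsArc π c d) (hac : π.part a = π.part c)
    (hax : a < x) (hxb : x < b) (hcx : c < x) (hxd : x < d) : a = c ∧ b = d := by
  rw [isArc_iff] at h h'
  obtain ⟨-, hb, h⟩ := h
  obtain ⟨-, hd, h'⟩ := h'
  have h1 := h c hac.symm
  have h2 := h d (hd.symm.trans hac.symm)
  have h3 := h' a hac
  have h4 := h' b (hb.symm.trans hac)
  grind

/-- For each ordered pair of blocks, at most one arc of the first crosses the span of the second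
from the left. -/
lemma ncard_arc_span_le {n : ℕ} (π : Finpartition (univ : Finset (Fin n))) :
    {q : (Fin n × Fin n) × (Fin n × Fin n) |
      IsArc π q.1.1 q.1.2 ∧ IsSpan π q.2.1 q.2.2 ∧ Interlace q}.ncard ≤ #π.parts.offDiag := by
  rw [← Set.ncard_coe_finset]
  refine Set.ncard_le_ncard_of_injOn (fun q => (π.part q.1.1, π.part q.2.1)) ?_ ?_
  · rintro ⟨⟨a, b⟩, c, d⟩ ⟨harc, -, h1, h2, -⟩
    simp only [mem_coe, mem_offDiag, π.part_mem, mem_univ, true_and]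
    exact fun h => (isArc_iff.1 harc).2.2 c h.symm ⟨h1, h2⟩
  · rintro ⟨⟨a, b⟩, c, d⟩ ⟨harc, hspan, h1, h2, -⟩
      ⟨⟨a', b'⟩, c', d'⟩ ⟨harc', hspan', h1', h2', -⟩ h
    simp only [Prod.mk.injEq] at h
    obtain ⟨rfl, rfl⟩ := hspan.unique hspan' h.2
    obtain ⟨rfl, rfl⟩ := harc.unique harc' h.1 h1 h2 h1' h2'
    rfl

/-- A span crossing a chord of another block from the left is determined by an ordered pair of
blocks: the pair of blocks is reversed when the other chord is not an arc, and the two kinds of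
crossing exclude each other. -/
lemma ncard_span_chord_le {n : ℕ} (π : Finpartition (univ : Finset (Fin n))) :
    {q : (Fin n × Fin n) × (Fin n × Fin n) |
      IsSpan π q.1.1 q.1.2 ∧ IsChord π q.2.1 q.2.2 ∧ Interlace q}.ncard ≤ #π.parts.offDiag := by
  classical
  rw [← Set.ncard_coe_finset]
  refine Set.ncard_le_ncard_of_injOn (fun q => if IsArc π q.2.1 q.2.2
    then (π.part q.1.1, π.part q.2.1) else (π.part q.2.1, π.part q.1.1)) ?_ ?_
  · rintro ⟨⟨a, b⟩, c, d⟩ ⟨hspan, hchord, -, -, h3⟩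
    have hcd : π.part c = π.part d := hchord.isArc_or_isSpan.elim
      (fun h => (isArc_iff.1 h).2.1) (fun h => h.2.1)
    have hne : π.part a ≠ π.part c := fun h =>
      (hspan.2.2 d (h.trans hcd).symm).2.not_gt h3
    dsimp only
    split_ifs
    · simpa [π.part_mem] using hne
    · simpa [π.part_mem] using hne.symm
  · have excl : ∀ {a b c d a' b' c' d' : Fin n}, IsSpan π a b → IsArc π c d →
        IsSpan π a' b' → IsSpan π c' d' → b < d → b' < d' →
        π.part a = π.part c' → π.part c = π.part a' → False := by
      intro a b c d a' b' c' d' hab hcd hab' hcd' h3 h3' h h'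
      obtain ⟨rfl, rfl⟩ := hab.unique hcd' h
      exact ((hab'.2.2 d ((isArc_iff.1 hcd).2.1.symm.trans h')).2.trans_lt h3').asymm h3
    rintro ⟨⟨a, b⟩, c, d⟩ ⟨hs, hc, h1, h2, h3⟩ ⟨⟨a', b'⟩, c', d'⟩ ⟨hs', hc', h1', h2', h3'⟩ h
    dsimp only at h hs hc h1 h2 h3 hs' hc' h1' h2' h3'
    by_cases harc : IsArc π c d <;> by_cases harc' : IsArc π c' d' <;>
      simp only [harc, harc', if_true, if_false, Prod.mk.injEq] at h
    · obtain ⟨rfl, rfl⟩ := hs.unique hs' h.1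
      obtain ⟨rfl, rfl⟩ := harc.unique harc' h.2 h2 h3 h2' h3'
      rfl
    · exact (excl hs harc hs' (hc'.isArc_or_isSpan.resolve_left harc') h3 h3' h.1 h.2).elim
    · exact (excl hs' harc' hs (hc.isArc_or_isSpan.resolve_left harc) h3' h3
        h.1.symm h.2.symm).elim
    · obtain ⟨rfl, rfl⟩ := hs.unique hs' h.2
      obtain ⟨rfl, rfl⟩ := (hc.isArc_or_isSpan.resolve_left harc).unique
        (hc'.isArc_or_isSpan.resolve_left harc') h.1
      rfl

/-- For any set partition of `[n]` with `k` blocks, `cr^ℓ(π) ≤ cr^c(π) ≤ cr^ℓ(π) + 2k(k-1)`. -/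
theorem crl_le_crc_le (n k : ℕ) (π : Finpartition (univ : Finset (Fin n)))
    (hk : π.parts.card = k) :
    crl π ≤ crc π ∧ crc π ≤ crl π + 2 * k * (k - 1) := by
  refine ⟨Set.ncard_le_ncard fun q hq => ⟨hq.1.isChord, hq.2.1.isChord, hq.2.2⟩, ?_⟩
  have hcard : 2 * k * (k - 1) = #π.parts.offDiag + #π.parts.offDiag := by
    rw [offDiag_card, hk, mul_assoc, Nat.mul_sub_one, two_mul]
  calc crc π ≤ _ := Set.ncard_le_ncard ?_
    _ ≤ _ := Set.ncard_union_le _ _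
    _ ≤ _ := add_le_add (Set.ncard_union_le _ _) (ncard_span_chord_le π)
    _ ≤ _ := add_le_add_left (add_le_add_right (ncard_arc_span_le π) (crl π)) _
    _ = crl π + 2 * k * (k - 1) := by rw [hcard, add_assoc]
  rintro q ⟨h1, h2, h⟩
  rcases h1.isArc_or_isSpan with h1 | h1
  · rcases h2.isArc_or_isSpan with h2 | h2
    · exact .inl (.inl ⟨h1, h2, h⟩)
    · exact .inl (.inr ⟨h1, h2, h⟩)
  · exact .inr ⟨h1, h2, h⟩
end
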